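/- For all n ≥ 0, 0 ≤ 2k ≤ n and 1 ≤ j ≤ dim H_{n-2k}^d, the Radon transform maps the orthonormal basis element f_{k,j}^n of V_n^d to R f_{k,j}^n(ξ,t) = γ_n g_{k,j}^n(ξ,t), where the singular values are γ_n = b_{d-1} √(n!/(d)_n) and depend only on n. -/

import Mathlib

open MeasureTheory Real Finset Filter Topology RealInnerProductSpace

noncomputable section

/-- `ℝ^d` with the Euclidean structure. -/
abbrev Esp (d : ℕ) := EuclideanSpace ℝ (Fin d)

/-- The Radon transform `R f(ξ, t)`: integral of `f` over the hyperplane `⟨ξ, x⟩ = t`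
intersected with the closed unit ball `B^d` (for `f` supported in `B^d` this is the integral
over the whole hyperplane). -/
def radon {d : ℕ} (f : Esp d → ℝ) (ξ : Esp d) (t : ℝ) : ℝ :=
  ∫ y in {y : ((ℝ ∙ ξ)ᗮ : Submodule ℝ (Esp d)) |
      t • ξ + (y : Esp d) ∈ Metric.closedBall (0 : Esp d) 1},
    f (t • ξ + (y : Esp d))

/-- The surface measure `dω` on the unit sphere `S^{d-1}`. -/
def sphereMeasure (d : ℕ) : Measure (Metric.sphere (0 : Esp d) 1) :=
  (volume : Measure (Esp d)).toSphere

/-- `σ_d = 2 π^{d/2} / Γ(d/2)`, the surface area of `S^{d-1}`. -/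
def sigmaConst (d : ℕ) : ℝ := 2 * Real.pi ^ ((d : ℝ) / 2) / Real.Gamma ((d : ℝ) / 2)

/-- `b_d = π^{d/2} / Γ((d+2)/2)`, the volume of the unit ball `B^d`. -/
def ballVol (d : ℕ) : ℝ := Real.pi ^ ((d : ℝ) / 2) / Real.Gamma (((d : ℝ) + 2) / 2)

/-- `c_λ = Γ(1/2) Γ(λ+1/2) / Γ(λ+1)`, normalization constant of `(1-t²)^{λ-1/2}` on `[-1,1]`. -/
def cConst (lam : ℝ) : ℝ := Real.Gamma (1 / 2) * Real.Gamma (lam + 1 / 2) / Real.Gamma (lam + 1)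

/-- Pochhammer symbol `(a)_k = a (a+1) ⋯ (a+k-1)`. -/
def poch (a : ℝ) (k : ℕ) : ℝ := ∏ i ∈ Finset.range k, (a + i)

/-- The Gegenbauer polynomial `C_n^λ(t)`, normalized by
`c_λ ∫_{-1}^1 C_k^λ C_l^λ (1-t²)^{λ-1/2} dt = (λ (2λ)_k / ((k+λ) k!)) δ_{k,l}`. -/
def gegen (lam : ℝ) (n : ℕ) (t : ℝ) : ℝ :=
  ∑ k ∈ Finset.range (n / 2 + 1),
    (-1 : ℝ) ^ k * Real.Gamma ((n : ℝ) - k + lam) /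
      (Real.Gamma lam * (Nat.factorial k) * (Nat.factorial (n - 2 * k))) * (2 * t) ^ (n - 2 * k)

/-- `h_n^{(λ)} = λ (2λ)_n / ((n+λ) n!)`, the square of the norm of `C_n^λ`. -/
def hGegen (lam : ℝ) (n : ℕ) : ℝ := lam * poch (2 * lam) n / (((n : ℝ) + lam) * n.factorial)

/-- The kernel `Φ_n(t,u) = Σ_{k=0}^n ((k+d/2)/(d/2)) C_k^{d/2}(t) C_k^{d/2}(u)`. -/
def Phi (d n : ℕ) (t u : ℝ) : ℝ :=
  ∑ k ∈ Finset.range (n + 1),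
    (((k : ℝ) + (d : ℝ) / 2) / ((d : ℝ) / 2)) * gegen ((d : ℝ) / 2) k t * gegen ((d : ℝ) / 2) k u

/-- The Jacobi polynomial `P_n^{(a,b)}`. -/
def jacobiP (a b : ℝ) (n : ℕ) (x : ℝ) : ℝ :=
  ∑ s ∈ Finset.range (n + 1),
    (Real.Gamma (a + n + 1) / (Real.Gamma (a + s + 1) * Nat.factorial (n - s))) *
      (Real.Gamma (b + n + 1) / (Real.Gamma (b + (n : ℝ) - s + 1) * Nat.factorial s)) *
      ((x - 1) / 2) ^ s * ((x + 1) / 2) ^ (n - s)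

/-- `h_k^{(a,b)}`, the square of the norm of `P_k^{(a,b)}` for the normalized Jacobi weight. -/
def hJacobi (a b : ℝ) (k : ℕ) : ℝ :=
  poch (a + 1) k * poch (b + 1) k * (a + b + k + 1) /
    (k.factorial * poch (a + b + 2) k * (a + b + 2 * k + 1))

/-- The orthonormal Jacobi polynomial `p_k^{(a,b)} = [h_k^{(a,b)}]^{-1/2} P_k^{(a,b)}`. -/
def jacobiOrtho (a b : ℝ) (k : ℕ) (x : ℝ) : ℝ := jacobiP a b k x / Real.sqrt (hJacobi a b k)

/-- The constant `h_{n,k}` with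
`h_{n,k}² = Γ((d+2)/2) Γ(n-2k+d/2) / (Γ(d/2) Γ(n-2k+(d+2)/2))`. -/
def hnk (d n k : ℕ) : ℝ :=
  Real.sqrt (Real.Gamma (((d : ℝ) + 2) / 2) * Real.Gamma ((n : ℝ) - 2 * k + (d : ℝ) / 2) /
    (Real.Gamma ((d : ℝ) / 2) * Real.Gamma ((n : ℝ) - 2 * k + ((d : ℝ) + 2) / 2)))

/-- The orthonormal basis element
`f_{k,j}^n(x) = h_{n,k}^{-1} p_k^{(0, n-2k+(d-2)/2)}(2‖x‖²-1) Y(x)` of `V_n^d`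
(for the Lebesgue measure, i.e. `μ = 1/2`), built from a spherical harmonic `Y` of
degree `n - 2k`. -/
def fkjBasis (d n k : ℕ) (Y : Esp d → ℝ) (x : Esp d) : ℝ :=
  (hnk d n k)⁻¹ * jacobiOrtho 0 ((n : ℝ) - 2 * k + ((d : ℝ) - 2) / 2) k (2 * ‖x‖ ^ 2 - 1) * Y x

/-- `g_{k,j}^n(ξ,t) = [h_n^{(d/2)}]^{-1/2} (1-t²)^{(d-1)/2} C_n^{d/2}(t) Y(ξ)`,
built from a spherical harmonic `Y` of degree `n - 2k`. -/
def gkjBasis (d n : ℕ) (Y : Esp d → ℝ) (ξ : Esp d) (t : ℝ) : ℝ :=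
  (Real.sqrt (hGegen ((d : ℝ) / 2) n))⁻¹ * (1 - t ^ 2) ^ (((d : ℝ) - 1) / 2) *
    gegen ((d : ℝ) / 2) n t * Y ξ

/-- `P : ℝ^d → ℝ` is (the evaluation of) a polynomial of total degree at most `n`. -/
def IsPolyDeg (d n : ℕ) (P : Esp d → ℝ) : Prop :=
  ∃ p : MvPolynomial (Fin d) ℝ, p.totalDegree ≤ n ∧
    ∀ x : Esp d, P x = MvPolynomial.eval (fun i => x i) p

/-- `P ∈ V_n^d`: `P` is a polynomial of degree at most `n` which is orthogonal, in
`L²(B^d, dx)`, to all polynomials of total degree `< n`. -/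
def MemV (d n : ℕ) (P : Esp d → ℝ) : Prop :=
  IsPolyDeg d n P ∧
    ∀ Q : Esp d → ℝ,
      (∃ q : MvPolynomial (Fin d) ℝ, q.totalDegree < n ∧
          ∀ x : Esp d, Q x = MvPolynomial.eval (fun i => x i) q) →
      ∫ x in Metric.closedBall (0 : Esp d) 1, P x * Q x = 0

/-- `p = proj_n f`, the orthogonal projection of `f` onto `V_n^d` in
`L²(B^d, b_d^{-1} dx)`: `p ∈ V_n^d` and `f - p ⟂ V_n^d`. -/
def IsProjOn (d n : ℕ) (f p : Esp d → ℝ) : Prop :=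
  MemV d n p ∧ ∀ Q : Esp d → ℝ, MemV d n Q →
    ∫ x in Metric.closedBall (0 : Esp d) 1, (f x - p x) * Q x = 0

/-- `P` is harmonic: its Laplacian vanishes identically. -/
def IsHarmonicFn {d : ℕ} (P : Esp d → ℝ) : Prop :=
  ∀ x : Esp d, ∑ i : Fin d,
    iteratedFDeriv ℝ 2 P x ![EuclideanSpace.single i 1, EuclideanSpace.single i 1] = 0

/-- `P` is homogeneous of degree `m`. -/
def IsHomogeneousDeg {d : ℕ} (m : ℕ) (P : Esp d → ℝ) : Prop :=
  ∀ (c : ℝ) (x : Esp d), P (c • x) = c ^ m * P x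

/-- `Y` is a (solid) spherical harmonic of degree `m`: a harmonic homogeneous
polynomial of degree `m`. -/
def IsSphHarm (d m : ℕ) (Y : Esp d → ℝ) : Prop :=
  IsPolyDeg d m Y ∧ IsHomogeneousDeg m Y ∧ IsHarmonicFn Y

/-- The inner product of `L²(Z, w^{1-d})`, `Z = S^{d-1} × [-1,1]`:
`⟨F,G⟩ = c_{d/2} ∫_{-1}^1 σ_d^{-1} ∫_{S^{d-1}} F(ξ,t) G(ξ,t) dω(ξ) (1-t²)^{(1-d)/2} dt`. -/
def innerZ (d : ℕ) (F G : Esp d → ℝ → ℝ) : ℝ :=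
  cConst ((d : ℝ) / 2) * ∫ t in (-1 : ℝ)..1,
    ((sigmaConst d)⁻¹ * ∫ ξ : Metric.sphere (0 : Esp d) 1, F ξ t * G ξ t ∂(sphereMeasure d)) *
      (1 - t ^ 2) ^ ((1 - (d : ℝ)) / 2)

/-- The inner product of `L²(B^d, b_d^{-1} dx)`. -/
def innerB (d : ℕ) (f g : Esp d → ℝ) : ℝ :=
  (ballVol d)⁻¹ * ∫ x in Metric.closedBall (0 : Esp d) 1, f x * g x

/-- The singular values `γ_n = b_{d-1} √(n!/(d)_n)` of the Radon transform. -/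
def svGamma (d n : ℕ) : ℝ := ballVol (d - 1) * Real.sqrt (n.factorial / poch (d : ℝ) n)


/-- The Chebyshev polynomial of the second kind `U_k`. -/
def chebU (k : ℕ) (t : ℝ) : ℝ := (Polynomial.Chebyshev.U ℝ (k : ℤ)).eval t

/-- The kernel `Φ_n(t,u) = Σ_{k=0}^n (k+1) U_k(t) U_k(u)` (the case `d = 2` of `Φ_n`). -/
def PhiU (n : ℕ) (t u : ℝ) : ℝ :=
  ∑ k ∈ Finset.range (n + 1), ((k : ℝ) + 1) * chebU k t * chebU k u

/-- The point `(cos θ, sin θ)` on the unit circle `S¹ ⊆ ℝ²`. -/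
def circlePt (θ : ℝ) : Esp 2 := (WithLp.equiv 2 (Fin 2 → ℝ)).symm ![Real.cos θ, Real.sin θ]

end

open Polynomial in
/-- The Gegenbauer operator `g ↦ (1 - x²) g'' - (2ν + 2) x g'` on real polynomials. -/
noncomputable def gegOp (ν : ℝ) : ℝ[X] →ₗ[ℝ] ℝ[X] where
  toFun g := (1 - X ^ 2) * derivative (derivative g) - C (2 * ν + 2) * X * derivative g
  map_add' p q := by simp only [derivative_add]; ring
  map_smul' c p := by simp only [smul_eq_C_mul, derivative_C_mul, RingHom.id_apply]; ring

lemma gegOp_apply (ν : ℝ) (g : Polynomial ℝ) :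
    gegOp ν g = (1 - Polynomial.X ^ 2) * Polynomial.derivative (Polynomial.derivative g) -
      Polynomial.C (2 * ν + 2) * Polynomial.X * Polynomial.derivative g := rfl

open Polynomial in
lemma gegOp_X_pow_mul (ν : ℝ) (a s : ℕ) :
    gegOp ν (X ^ a * (1 - X ^ 2) ^ s) =
      C ((a : ℝ) * (a - 1)) * (X ^ (a - 2) * (1 - X ^ 2) ^ (s + 1)) +
      C (4 * (s : ℝ) * (s + ν)) * (X ^ (a + 2) * (1 - X ^ 2) ^ (s - 1)) -
      C (2 * (s : ℝ) * (2 * a + 1) + (2 * ν + 2) * a) * (X ^ a * (1 - X ^ 2) ^ s) := by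
  have h2 : (C 2 : ℝ[X]) = 2 := map_ofNat C 2
  have h4 : (C 4 : ℝ[X]) = 4 := map_ofNat C 4
  rw [gegOp_apply]
  rcases a with _ | _ | a <;> rcases s with _ | _ | s <;>
    simp [derivative_pow, h2, h4] <;> ring

open Polynomial in
lemma eq_zero_of_iterate_derivative_eval_eq_zero (g : ℝ[X]) (x : ℝ)
    (h : ∀ r, (derivative^[r] g).eval x = 0) : g = 0 := by
  apply taylor_injective x
  ext r
  rw [taylor_coeff, map_zero, coeff_zero]
  have h1 := congrArg (eval x) (congrFun (factorial_smul_hasseDeriv (R := ℝ) r) g)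
  rw [h r] at h1
  simpa [Nat.factorial_ne_zero] using h1

open Polynomial in
/-- A polynomial eigenfunction of the Gegenbauer operator vanishing at `1` is zero. -/
lemma gegOp_unique (ν μ : ℝ) (hν : 0 ≤ ν) (g : ℝ[X]) (hg : gegOp ν g + C μ * g = 0)
    (h1 : g.eval 1 = 0) : g = 0 := by
  have key : ∀ r : ℕ, ∃ μ' : ℝ, (1 - X ^ 2) * derivative^[r + 2] g -
      C (2 * r + 2 * ν + 2) * X * derivative^[r + 1] g + C μ' * derivative^[r] g = 0 := by
    intro r
    induction r with
    | zero =>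
      refine ⟨μ, ?_⟩
      rw [gegOp_apply] at hg
      simpa using hg
    | succ r ih =>
      obtain ⟨μ', h⟩ := ih
      refine ⟨μ' - (2 * r + 2 * ν + 2), ?_⟩
      have h2 := congrArg derivative h
      simp only [derivative_add, derivative_sub, derivative_mul, derivative_one, derivative_X_pow,
        derivative_C, derivative_X, derivative_zero,
        ← Function.iterate_succ_apply' (f := (derivative : ℝ[X] → ℝ[X]))] at h2
      rw [← h2]
      simp only [Nat.succ_eq_add_one]
      push_cast
      simp only [map_add, map_sub, map_mul, map_ofNat, map_natCast, map_one]
      ring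
  apply eq_zero_of_iterate_derivative_eval_eq_zero g 1
  intro r
  induction r with
  | zero => simpa using h1
  | succ r ih =>
    obtain ⟨μ', h⟩ := key r
    have h2 := congrArg (eval 1) h
    simp only [eval_add, eval_sub, eval_mul, eval_one, eval_pow, eval_X, eval_C, ih,
      eval_zero] at h2
    have h3 : (2 * (r : ℝ) + 2 * ν + 2) ≠ 0 := by positivity
    have h4 : (2 * (r : ℝ) + 2 * ν + 2) * eval 1 (derivative^[r + 1] g) = 0 := by linarith
    exact (mul_eq_zero.mp h4).resolve_left h3

/-- The coefficient of `t ^ (n - 2 * k)` in `C_n^λ(t)`. -/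
noncomputable def gegenCoeff (lam : ℝ) (n k : ℕ) : ℝ :=
  (-1 : ℝ) ^ k * Real.Gamma ((n : ℝ) - k + lam) /
      (Real.Gamma lam * (Nat.factorial k) * (Nat.factorial (n - 2 * k))) * 2 ^ (n - 2 * k)

open Polynomial in
/-- The Gegenbauer polynomial as an element of `ℝ[X]`. -/
noncomputable def gegenPoly (lam : ℝ) (n : ℕ) : ℝ[X] :=
  ∑ k ∈ Finset.range (n / 2 + 1), C (gegenCoeff lam n k) * X ^ (n - 2 * k)

lemma eval_gegenPoly (lam : ℝ) (n : ℕ) (t : ℝ) : (gegenPoly lam n).eval t = gegen lam n t := by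
  simp only [gegenPoly, gegen, Polynomial.eval_finsetSum, gegenCoeff, Polynomial.eval_mul,
    Polynomial.eval_C, Polynomial.eval_pow, Polynomial.eval_X, mul_pow]
  exact Finset.sum_congr rfl fun k _ => by ring

lemma gegenCoeff_succ (lam : ℝ) (hl : 0 < lam) (n k : ℕ) (h : 2 * (k + 1) ≤ n) :
    gegenCoeff lam n (k + 1) * (4 * (k + 1) * (n - (k + 1) + lam)) =
      -(gegenCoeff lam n k * ((n - 2 * k : ℝ) * (n - 2 * k - 1))) := by
  obtain ⟨a, rfl⟩ := Nat.exists_eq_add_of_le h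
  have e1 : 2 * (k + 1) + a - 2 * (k + 1) = a := by omega
  have e2 : 2 * (k + 1) + a - 2 * k = a + 2 := by omega
  have hx : (0 : ℝ) < k + 1 + a + lam := by positivity
  have hG := Real.Gamma_add_one hx.ne'
  have hG0 := (Real.Gamma_pos_of_pos hl).ne'
  simp only [gegenCoeff, e1, e2]
  push_cast
  rw [show 2 * ((k : ℝ) + 1) + a - (k + 1) + lam = k + 1 + a + lam by ring,
    show 2 * ((k : ℝ) + 1) + a - k + lam = k + 1 + a + lam + 1 by ring, hG]
  simp only [Nat.factorial_succ]
  push_cast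
  have := Nat.factorial_ne_zero k
  have := Nat.factorial_ne_zero a
  field_simp
  ring

open Polynomial in
lemma gegOp_gegenPoly (ν : ℝ) (hν : 0 ≤ ν) (n : ℕ) :
    gegOp ν (gegenPoly (ν + 1 / 2) n) +
      C (n * (n + 2 * ν + 1)) * gegenPoly (ν + 1 / 2) n = 0 := by
  set lam := ν + 1 / 2 with hlam
  have hl : 0 < lam := by positivity
  let B : ℕ → ℝ[X] := fun k =>
    C (gegenCoeff lam n k * (4 * k * (n - k + lam))) * X ^ (n - 2 * k)
  have key : ∀ k ∈ Finset.range (n / 2 + 1), gegOp ν (C (gegenCoeff lam n k) * X ^ (n - 2 * k)) +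
      C (n * (n + 2 * ν + 1)) * (C (gegenCoeff lam n k) * X ^ (n - 2 * k)) =
      B k - (if k < n / 2 then B (k + 1) else 0) := by
    intro k hk
    have hk' : 2 * k ≤ n := by have := Finset.mem_range.mp hk; omega
    have h := gegOp_X_pow_mul ν (n - 2 * k) 0
    simp only [pow_zero, mul_one] at h
    rw [← smul_eq_C_mul, map_smul, h]
    simp only [smul_eq_C_mul]
    have hc : ((n - 2 * k : ℕ) : ℝ) = n - 2 * k := by push_cast [hk']; ring
    have hsplit2 : C (((n - 2 * k : ℕ) : ℝ) * ((n - 2 * k : ℕ) - 1)) * (X : ℝ[X]) ^ (n - 2 * k - 2) *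
        X ^ 2 = C (((n - 2 * k : ℕ) : ℝ) * ((n - 2 * k : ℕ) - 1)) * X ^ (n - 2 * k) := by
      rcases n - 2 * k with _ | _ | a <;> simp
      ring
    have hlast : C (gegenCoeff lam n k) * (C (((n - 2 * k : ℕ) : ℝ) * ((n - 2 * k : ℕ) - 1)) *
        (X : ℝ[X]) ^ (n - 2 * k - 2)) = -(if k < n / 2 then B (k + 1) else 0) := by
      split_ifs with hlt
      · have h2 : 2 * (k + 1) ≤ n := by omega
        have := gegenCoeff_succ lam hl n k h2
        simp only [B]
        push_cast
        rw [this, hc, show n - 2 * k - 2 = n - 2 * (k + 1) by omega]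
        simp only [map_neg, map_mul]
        ring
      · have : n - 2 * k = 0 ∨ n - 2 * k = 1 := by omega
        rcases this with h0 | h0 <;> simp [h0]
    have e : ∀ Q : ℝ[X], C (gegenCoeff lam n k) *
        (C (((n - 2 * k : ℕ) : ℝ) * ((n - 2 * k : ℕ) - 1)) *
        ((X : ℝ[X]) ^ (n - 2 * k - 2) * (1 - X ^ 2)) + 0 - Q) =
        C (gegenCoeff lam n k) * (C (((n - 2 * k : ℕ) : ℝ) * ((n - 2 * k : ℕ) - 1)) *
        (X : ℝ[X]) ^ (n - 2 * k - 2)) -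
        C (gegenCoeff lam n k) * (C (((n - 2 * k : ℕ) : ℝ) * ((n - 2 * k : ℕ) - 1)) *
        X ^ (n - 2 * k)) - C (gegenCoeff lam n k) * Q := by
      intro Q
      rw [← hsplit2]; ring
    simp only [Nat.cast_zero, mul_zero, zero_mul, map_zero, zero_add, pow_one]
    rw [e, hlast, hc]
    simp only [B, hlam, map_mul, map_add, map_sub, map_natCast, map_ofNat, map_one]
    have hh : (C (1 / 2) : ℝ[X]) * 2 = 1 := by
      rw [← map_ofNat C 2, ← C_mul]; norm_num
    linear_combination (2 * C (gegenCoeff (ν + 1 / 2) n k) * (k : ℝ[X]) * X ^ (n - 2 * k)) * (-hh)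
  have hsum := Finset.sum_congr rfl key
  rw [Finset.sum_add_distrib, ← map_sum, ← Finset.mul_sum] at hsum
  rw [gegenPoly, hsum, Finset.sum_sub_distrib, Finset.sum_range_succ', Finset.sum_range_succ]
  simp only [B, lt_irrefl, if_false, Nat.cast_zero, mul_zero, zero_mul, map_zero, add_zero]
  rw [sub_eq_zero]
  refine Finset.sum_congr rfl fun k hk => ?_
  rw [if_pos (Finset.mem_range.mp hk)]

lemma poch_succ (a : ℝ) (k : ℕ) : poch a (k + 1) = poch a k * (a + k) := by
  simp [poch, Finset.prod_range_succ]

lemma poch_succ' (a : ℝ) (k : ℕ) : poch a (k + 1) = a * poch (a + 1) k := by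
  simp only [poch, Finset.prod_range_succ', Nat.cast_zero, add_zero]
  rw [mul_comm]
  congr 1
  exact Finset.prod_congr rfl fun i _ => by push_cast; ring

lemma poch_pos {a : ℝ} (ha : 0 < a) (k : ℕ) : 0 < poch a k :=
  Finset.prod_pos fun i _ => by positivity

open Polynomial in
lemma derivative_gegenPoly_succ (lam : ℝ) (hl : 0 < lam) (n : ℕ) :
    derivative (gegenPoly lam (n + 1)) = C (2 * lam) * gegenPoly (lam + 1) n := by
  have hterm : ∀ k, 2 * k ≤ n →
      derivative (C (gegenCoeff lam (n + 1) k) * (X : ℝ[X]) ^ (n + 1 - 2 * k)) =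
        C (2 * lam) * (C (gegenCoeff (lam + 1) n k) * X ^ (n - 2 * k)) := by
    intro k hk
    obtain ⟨a, rfl⟩ := Nat.exists_eq_add_of_le hk
    have e1 : 2 * k + a + 1 - 2 * k = a + 1 := by omega
    have e2 : 2 * k + a - 2 * k = a := by omega
    rw [derivative_C_mul, derivative_X_pow, e1, e2, ← mul_assoc, ← mul_assoc, ← C_mul, ← C_mul]
    congr 2
    simp only [gegenCoeff, e1, e2]
    rw [Real.Gamma_add_one hl.ne', Nat.factorial_succ]
    have hG0 := (Real.Gamma_pos_of_pos hl).ne'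
    have := Nat.factorial_ne_zero k
    have := Nat.factorial_ne_zero a
    push_cast
    rw [show 2 * (k : ℝ) + a + 1 - k + lam = 2 * k + a - k + (lam + 1) by ring]
    field_simp
    ring
  rw [gegenPoly, gegenPoly, derivative_sum, Finset.mul_sum]
  rcases Nat.even_or_odd' n with ⟨r, rfl | rfl⟩
  · rw [show (2 * r + 1) / 2 = r by omega, show (2 * r) / 2 = r by omega]
    exact Finset.sum_congr rfl fun k hk => hterm k (by have := Finset.mem_range.mp hk; omega)
  · rw [show (2 * r + 1 + 1) / 2 = r + 1 by omega, show (2 * r + 1) / 2 = r by omega,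
      Finset.sum_range_succ]
    rw [show 2 * r + 1 + 1 - 2 * (r + 1) = 0 by omega]
    simp only [pow_zero, mul_one, derivative_C, add_zero]
    exact Finset.sum_congr rfl fun k hk => hterm k (by have := Finset.mem_range.mp hk; omega)

open Polynomial in
/-- `C_n^λ(1) = (2λ)_n / n!`, for `λ = ν + 1/2`. -/
lemma gegenPoly_eval_one (n : ℕ) : ∀ ν : ℝ, 0 ≤ ν →
    (gegenPoly (ν + 1 / 2) n).eval 1 = poch (2 * ν + 1) n / n.factorial := by
  induction n with
  | zero =>
    intro ν hν
    have h := (Real.Gamma_pos_of_pos (show 0 < ν + 1 / 2 by positivity)).ne'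
    simp only [gegenPoly, gegenCoeff, poch]
    simp
    simpa using h
  | succ n ih =>
    intro ν hν
    have h := congrArg (eval 1) (gegOp_gegenPoly ν hν (n + 1))
    rw [gegOp_apply, derivative_gegenPoly_succ _ (by positivity),
      show ν + 1 / 2 + 1 = (ν + 1) + 1 / 2 by ring] at h
    simp only [eval_add, eval_sub, eval_mul, eval_C, eval_one, eval_pow, eval_X, eval_zero,
      ih (ν + 1) (by positivity)] at h
    have e2 : poch (2 * (ν + 1) + 1) n * ((2 * ν + 1) * (2 * ν + 2)) =
        poch (2 * ν + 1) (n + 1) * (2 * ν + 1 + (n + 1)) := by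
      rw [← Nat.cast_succ, ← poch_succ, poch_succ', poch_succ']
      ring_nf
    have hn : (0 : ℝ) < n + 1 := by positivity
    have hn2 : (0 : ℝ) < n + 1 + 2 * ν + 1 := by positivity
    have hf := Nat.factorial_ne_zero n
    rw [Nat.factorial_succ]
    push_cast at h ⊢
    rw [eq_div_iff (by positivity)]
    apply mul_left_cancel₀ hn2.ne'
    have h' : (n + 1 + 2 * ν + 1) * ((n + 1) * eval 1 (gegenPoly (ν + 1 / 2) (n + 1))) =
        (2 * ν + 2) * ((2 * ν + 1) * (poch (2 * (ν + 1) + 1) n / n.factorial)) := by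
      linear_combination h
    generalize eval 1 (gegenPoly (ν + 1 / 2) (n + 1)) = E at h' ⊢
    field_simp at h'
    linear_combination h' + e2

/-- Coefficients of the expansion of `C_n^{ν + 1/2}`, `n = m + 2k`, in the functions
`t^(m - 2j) (1 - t²)^(i + j)`. -/
noncomputable def mixedCoeff (ν : ℝ) (m k i j : ℕ) : ℝ :=
  (-1) ^ (i + j) * k.choose i * poch (k + m + ν + 1 / 2) i * m.factorial /
    ((m - 2 * j).factorial * 4 ^ j * j.factorial * poch (ν + 1) (i + j))

lemma mixedCoeff_succ_right (ν : ℝ) (hν : 0 ≤ ν) (m k i j : ℕ) (h : 2 * (j + 1) ≤ m) :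
    mixedCoeff ν m k i (j + 1) * (4 * (j + 1) * (i + j + 1 + ν)) =
      -(mixedCoeff ν m k i j * ((m - 2 * j : ℝ) * (m - 2 * j - 1))) := by
  obtain ⟨a, rfl⟩ := Nat.exists_eq_add_of_le h
  have e1 : 2 * (j + 1) + a - 2 * (j + 1) = a := by omega
  have e2 : 2 * (j + 1) + a - 2 * j = a + 2 := by omega
  have hp := (poch_pos (show 0 < ν + 1 by positivity) (i + j)).ne'
  have hx : (ν + 1 + (i + j : ℕ)) ≠ 0 := by positivity
  simp only [mixedCoeff, e1, e2, ← add_assoc, poch_succ (ν + 1), Nat.factorial_succ]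
  have := Nat.factorial_ne_zero j
  have := Nat.factorial_ne_zero a
  push_cast at hx ⊢
  field_simp
  ring

lemma mixedCoeff_succ_left (ν : ℝ) (hν : 0 ≤ ν) (m k i j : ℕ) (h : i ≤ k) :
    mixedCoeff ν m k (i + 1) j * (4 * (i + 1) * (i + j + 1 + ν)) =
      -(mixedCoeff ν m k i j * (4 * (k - i) * (k + m + ν + 1 / 2 + i))) := by
  have hc : (k.choose (i + 1) : ℝ) * (i + 1) = k.choose i * (k - i) := by
    have := Nat.choose_succ_right_eq k i
    rw [← Nat.cast_sub h]
    exact_mod_cast this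
  have hp := (poch_pos (show 0 < ν + 1 by positivity) (i + j)).ne'
  have hx : (ν + 1 + (i + j : ℕ)) ≠ 0 := by positivity
  simp only [mixedCoeff]
  rw [show i + 1 + j = i + j + 1 by ring]
  simp only [poch_succ]
  have := Nat.factorial_ne_zero j
  have := Nat.factorial_ne_zero (m - 2 * j)
  push_cast at hx ⊢
  generalize poch (k + m + ν + 1 / 2) i = P
  field_simp
  rw [pow_succ]
  linear_combination (-(-1 : ℝ) ^ (i + j) * P * (i + j + 1 + ν)) * hc

open Polynomial in
/-- The expansion of `C_n^{ν + 1/2}`, up to normalization, in the functions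
`t^(m - 2j) (1 - t²)^(i + j)`. -/
noncomputable def mixedPoly (ν : ℝ) (m k : ℕ) : ℝ[X] :=
  ∑ i ∈ Finset.range (k + 1), ∑ j ∈ Finset.range (m / 2 + 1),
    C (mixedCoeff ν m k i j) * (X ^ (m - 2 * j) * (1 - X ^ 2) ^ (i + j))

open Polynomial in
lemma gegOp_mixedPoly (ν : ℝ) (hν : 0 ≤ ν) (m k : ℕ) :
    gegOp ν (mixedPoly ν m k) + C ((m + 2 * k) * (m + 2 * k + 2 * ν + 1)) * mixedPoly ν m k = 0 := by
  let E : ℕ → ℕ → ℝ[X] := fun a s => X ^ a * (1 - X ^ 2) ^ s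
  let A : ℕ → ℕ → ℝ := mixedCoeff ν m k
  let Yt : ℕ → ℕ → ℝ[X] := fun i j =>
    if j = m / 2 + 1 then 0 else C (4 * j * (i + j + ν) * A i j) * E (m - 2 * j) (i + j)
  let Xs : ℕ → ℕ → ℝ[X] := fun i j =>
    -(if j = m / 2 + 1 then 0 else C (4 * j * (i + j + ν) * A i j) * E (m - 2 * j + 2) (i + j - 1))
  let Zs : ℕ → ℕ → ℝ[X] := fun i j =>
    if i = k + 1 then 0 else -(C (4 * i * (i + j + ν) * A i j) * E (m - 2 * j) (i + j - 1))
  have key : ∀ i ∈ Finset.range (k + 1), ∀ j ∈ Finset.range (m / 2 + 1),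
      gegOp ν (C (A i j) * E (m - 2 * j) (i + j)) +
        C ((m + 2 * k) * (m + 2 * k + 2 * ν + 1)) * (C (A i j) * E (m - 2 * j) (i + j)) =
      -(Yt i (j + 1) - Yt i j) + (Xs i (j + 1) - Xs i j) + (Zs (i + 1) j - Zs i j) := by
    intro i hi j hj
    have hi' : i ≤ k := by have := Finset.mem_range.mp hi; omega
    have hj' : 2 * j ≤ m := by have := Finset.mem_range.mp hj; omega
    have hc : ((m - 2 * j : ℕ) : ℝ) = m - 2 * j := by push_cast [hj']; ring
    have hjn : j ≠ m / 2 + 1 := by have := Finset.mem_range.mp hj; omega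
    have hin : i ≠ k + 1 := by omega
    -- the term obtained by lowering the power of `t`
    have hY : Yt i (j + 1) = -(C (A i j * ((m - 2 * j) * (m - 2 * j - 1))) *
        E (m - 2 * j - 2) (i + j + 1)) := by
      simp only [Yt]
      split_ifs with h
      · have : m - 2 * j = 0 ∨ m - 2 * j = 1 := by omega
        rcases this with h0 | h0 <;> rw [← hc, h0] <;> simp
      · have h2 : 2 * (j + 1) ≤ m := by omega
        have := mixedCoeff_succ_right ν hν m k i j h2
        rw [← neg_mul, ← C_neg]
        congr 1
        · congr 1
          push_cast
          simp only [A]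
          linear_combination this
    have hX : Xs i (j + 1) = C (A i j * ((m - 2 * j) * (m - 2 * j - 1))) *
        E (m - 2 * j) (i + j) := by
      simp only [Xs]
      split_ifs with h
      · have : m - 2 * j = 0 ∨ m - 2 * j = 1 := by omega
        rcases this with h0 | h0 <;> rw [← hc, h0] <;> simp
      · have h2 : 2 * (j + 1) ≤ m := by omega
        have := mixedCoeff_succ_right ν hν m k i j h2
        rw [← neg_mul, ← C_neg, show m - 2 * (j + 1) + 2 = m - 2 * j by omega,
          show i + (j + 1) - 1 = i + j by omega]
        congr 1
        · congr 1
          push_cast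
          simp only [A]
          linear_combination -this
    have hZ : Zs (i + 1) j = C (A i j * (4 * (k - i) * (k + m + ν + 1 / 2 + i))) *
        E (m - 2 * j) (i + j) := by
      simp only [Zs]
      split_ifs with h
      · have : i = k := by omega
        rw [this]; simp
      · have := mixedCoeff_succ_left ν hν m k i j hi'
        rw [← neg_mul, ← C_neg, show i + 1 + j - 1 = i + j by omega]
        congr 1
        · congr 1
          push_cast
          simp only [A]
          linear_combination -this
    have hsplit : C (4 * (i : ℝ) * (i + j + ν)) * E (m - 2 * j + 2) (i + j - 1) =
        C (4 * (i : ℝ) * (i + j + ν)) * E (m - 2 * j) (i + j - 1) -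
        C (4 * (i : ℝ) * (i + j + ν)) * E (m - 2 * j) (i + j) := by
      rcases i with _ | i
      · simp
      · simp only [E]
        rw [show i + 1 + j - 1 = i + j by omega, show i + 1 + j = i + j + 1 by omega]
        ring
    have hL := gegOp_X_pow_mul ν (m - 2 * j) (i + j)
    rw [← smul_eq_C_mul, map_smul]
    change A i j • gegOp ν (X ^ (m - 2 * j) * (1 - X ^ 2) ^ (i + j)) + _ = _
    rw [hL, hY, hX, hZ, hc]
    simp only [Yt, Xs, Zs, if_neg hjn, if_neg hin]
    simp only [smul_eq_C_mul]
    change C (A i j) * (C _ * E (m - 2 * j - 2) (i + j + 1) +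
      C _ * E (m - 2 * j + 2) (i + j - 1) - C _ * E (m - 2 * j) (i + j)) + _ = _
    have hcst : 2 * ((i + j : ℕ) : ℝ) * (2 * (m - 2 * j) + 1) + (2 * ν + 2) * (m - 2 * j) =
        (m + 2 * k) * (m + 2 * k + 2 * ν + 1) - (m - 2 * j) * (m - 2 * j - 1)
          - 4 * j * (i + j + ν) - 4 * (k - i) * (k + m + ν + 1 / 2 + i) - 4 * i * (i + j + ν) := by
      push_cast; ring
    have hcst2 : 4 * ((i + j : ℕ) : ℝ) * ((i + j : ℕ) + ν) =
        4 * i * (i + j + ν) + 4 * j * (i + j + ν) := by push_cast; ring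
    rw [hcst, hcst2]
    generalize E (m - 2 * j + 2) (i + j - 1) = E1 at *
    generalize E (m - 2 * j) (i + j) = E2 at *
    generalize E (m - 2 * j) (i + j - 1) = E3 at *
    generalize E (m - 2 * j - 2) (i + j + 1) = E4 at *
    generalize (4 * (i : ℝ) * (i + j + ν)) = c1 at *
    generalize (4 * (j : ℝ) * (i + j + ν)) = c2 at *
    generalize (4 * ((k : ℝ) - i) * (k + m + ν + 1 / 2 + i)) = c3 at *
    generalize (((m : ℝ) - 2 * j) * (m - 2 * j - 1)) = c4 at *
    simp only [map_add, map_sub, map_mul]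
    linear_combination C (A i j) * hsplit
  have hM : mixedPoly ν m k = ∑ i ∈ Finset.range (k + 1), ∑ j ∈ Finset.range (m / 2 + 1),
    C (A i j) * E (m - 2 * j) (i + j) := rfl
  rw [hM]
  simp only [map_sum, Finset.mul_sum, ← Finset.sum_add_distrib]
  rw [Finset.sum_congr rfl fun i hi => Finset.sum_congr rfl (key i hi)]
  have hY0 : ∀ i, ∑ j ∈ Finset.range (m / 2 + 1), (Yt i (j + 1) - Yt i j) = 0 := fun i => by
    rw [Finset.sum_range_sub (Yt i)]; simp [Yt]
  have hX0 : ∀ i, ∑ j ∈ Finset.range (m / 2 + 1), (Xs i (j + 1) - Xs i j) = 0 := fun i => by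
    rw [Finset.sum_range_sub (Xs i)]; simp [Xs]
  have hZ0 : ∀ j, ∑ i ∈ Finset.range (k + 1), (Zs (i + 1) j - Zs i j) = 0 := fun j => by
    rw [Finset.sum_range_sub (fun i => Zs i j)]; simp [Zs]
  simp only [Finset.sum_add_distrib, Finset.sum_neg_distrib, hY0, hX0]
  rw [Finset.sum_comm]
  simp [hZ0]

open Polynomial in
lemma mixedPoly_eval_one (ν : ℝ) (m k : ℕ) : (mixedPoly ν m k).eval 1 = 1 := by
  simp only [mixedPoly, eval_finsetSum, eval_mul, eval_C, eval_pow, eval_X, eval_sub, eval_one,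
    one_pow, sub_self, one_mul]
  rw [Finset.sum_eq_single_of_mem 0 (by simp), Finset.sum_eq_single_of_mem 0 (by simp)]
  · have := Nat.factorial_ne_zero m
    simp [mixedCoeff, poch, this]
  · intro j _ hj
    simp [hj]
  · intro i _ hi
    exact Finset.sum_eq_zero fun j _ => by simp [hi]

open Polynomial in
lemma mixedPoly_eq (ν : ℝ) (hν : 0 ≤ ν) (m k : ℕ) :
    mixedPoly ν m k = C ((m + 2 * k).factorial / poch (2 * ν + 1) (m + 2 * k)) *
      gegenPoly (ν + 1 / 2) (m + 2 * k) := by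
  have hp := (poch_pos (show 0 < 2 * ν + 1 by positivity) (m + 2 * k)).ne'
  have hf : ((m + 2 * k).factorial : ℝ) ≠ 0 := by exact_mod_cast Nat.factorial_ne_zero _
  rw [← sub_eq_zero]
  apply gegOp_unique ν ((m + 2 * k) * (m + 2 * k + 2 * ν + 1)) hν
  · have h1 := gegOp_mixedPoly ν hν m k
    have h2 := gegOp_gegenPoly ν hν (m + 2 * k)
    rw [map_sub, ← smul_eq_C_mul, map_smul]
    simp only [smul_eq_C_mul]
    push_cast at h2
    linear_combination h1 - C ((m + 2 * k).factorial / poch (2 * ν + 1) (m + 2 * k)) * h2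
  · rw [eval_sub, eval_mul, eval_C, mixedPoly_eval_one, gegenPoly_eval_one _ ν hν]
    field_simp
    simp

/-- The expansion of the Gegenbauer polynomial in `t^(m - 2j) (1 - t²)^(i + j)`. -/
lemma sum_mixedCoeff (ν : ℝ) (hν : 0 ≤ ν) (m k : ℕ) (t : ℝ) :
    ∑ i ∈ Finset.range (k + 1), ∑ j ∈ Finset.range (m / 2 + 1),
      mixedCoeff ν m k i j * (t ^ (m - 2 * j) * (1 - t ^ 2) ^ (i + j)) =
    (m + 2 * k).factorial / poch (2 * ν + 1) (m + 2 * k) * gegen (ν + 1 / 2) (m + 2 * k) t := by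
  have h := congrArg (Polynomial.eval t) (mixedPoly_eq ν hν m k)
  simpa [mixedPoly, Polynomial.eval_finsetSum, eval_gegenPoly] using h

lemma ring_choose_real_succ (r : ℝ) (s : ℕ) :
    Ring.choose r (s + 1) * (s + 1) = Ring.choose r s * (r - s) := by
  have h1 := Nat.cast_ne_zero (R := ℝ).2 s.factorial_ne_zero
  rw [Ring.choose_eq_smul, Ring.choose_eq_smul, descPochhammer_succ_right, Polynomial.smeval_mul]
  simp only [Polynomial.smeval_sub, Polynomial.smeval_X, Polynomial.smeval_natCast, smul_eq_mul,
    Nat.factorial_succ]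
  push_cast
  field_simp
  simp

lemma ring_choose_real_add (r : ℝ) (i : ℕ) :
    Ring.choose (r + i) i = poch (r + 1) i / i.factorial := by
  have h1 := Nat.cast_ne_zero (R := ℝ).2 i.factorial_ne_zero
  have h2 := Ring.multichoose_eq (r + 1) i
  have h3 := Ring.factorial_nsmul_multichoose_eq_ascPochhammer (r + 1) i
  rw [show r + 1 + i - 1 = r + i by ring] at h2
  rw [← h2, eq_div_iff h1, mul_comm, ← nsmul_eq_mul, h3, Polynomial.ascPochhammer_smeval_eq_eval]
  clear h1 h2 h3
  induction i with
  | zero => simp [poch]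
  | succ i ih => rw [ascPochhammer_succ_eval, ih, poch_succ]

lemma Gamma_div_eq_choose (b : ℝ) (hb : -1 < b) (k s : ℕ) (hs : s ≤ k) :
    Real.Gamma (b + k + 1) / (Real.Gamma (b + k - s + 1) * s.factorial) =
      Ring.choose (b + k) s := by
  induction s with
  | zero =>
    have : 0 < Real.Gamma (b + k + 1) := Real.Gamma_pos_of_pos (by
      have : (0 : ℝ) ≤ k := k.cast_nonneg
      linarith)
    simp [this.ne']
  | succ s ih =>
    have hsk : (s : ℝ) + 1 ≤ k := by exact_mod_cast hs
    have hpos : 0 < b + k - s := by linarith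
    have hG := (Real.Gamma_pos_of_pos hpos).ne'
    have h1 := Nat.cast_ne_zero (R := ℝ).2 s.factorial_ne_zero
    have h2 : (s : ℝ) + 1 ≠ 0 := by positivity
    have h := ring_choose_real_succ (b + k) s
    rw [← ih (by omega), Real.Gamma_add_one hpos.ne'] at h
    rw [← mul_left_inj' h2, h, Nat.factorial_succ]
    push_cast
    rw [show b + k - (s + 1) + 1 = b + k - s by ring]
    field_simp

/-- The expansion of the Jacobi polynomial `P_k^{(0,b)}` in powers of `1 - x`. -/
lemma jacobiP_zero_eq (b : ℝ) (hb : -1 < b) (k : ℕ) (x : ℝ) :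
    jacobiP 0 b k (2 * x - 1) = ∑ i ∈ Finset.range (k + 1),
      (-1) ^ i * k.choose i * poch (b + k + 1) i / i.factorial * (1 - x) ^ i := by
  have h1 : jacobiP 0 b k (2 * x - 1) = ∑ s ∈ Finset.range (k + 1), ∑ i ∈ Finset.range (k + 1),
      (if s ≤ i then (-1) ^ i * k.choose i * (i.choose s * Ring.choose (b + k) s) * (1 - x) ^ i
        else 0) := by
    refine Finset.sum_congr rfl fun s hs => ?_
    have hsk : s ≤ k := by simpa [Nat.lt_succ_iff] using hs
    rw [Gamma_div_eq_choose b hb k s hsk, ← Finset.sum_filter]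
    have hc : Real.Gamma (0 + k + 1) / (Real.Gamma (0 + s + 1) * (k - s).factorial) =
        k.choose s := by
      rw [zero_add, zero_add, Real.Gamma_nat_eq_factorial, Real.Gamma_nat_eq_factorial,
        Nat.cast_choose ℝ hsk]
    have hf : (Finset.range (k + 1)).filter (fun i => s ≤ i) =
        (Finset.range (k - s + 1)).map (addRightEmbedding s) := by
      ext i
      simp only [Finset.mem_filter, Finset.mem_range, Finset.mem_map, addRightEmbedding_apply]
      constructor
      · rintro ⟨h1, h2⟩
        exact ⟨i - s, by omega, by omega⟩
      · rintro ⟨a, h1, rfl⟩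
        omega
    rw [hc, hf, Finset.sum_map, show (2 * x - 1 + 1) / 2 = -(1 - x) + 1 by ring,
      show (2 * x - 1 - 1) / 2 = -(1 - x) by ring, add_pow, Finset.mul_sum]
    refine Finset.sum_congr rfl fun i hi => ?_
    have hi' : i + s ≤ k := by simp at hi; omega
    have hch : (k.choose (i + s) : ℝ) * (i + s).choose s = k.choose s * (k - s).choose i := by
      have := Nat.choose_mul (n := k) (k := i + s) (s := s) (by omega)
      rw [Nat.add_sub_cancel] at this
      exact_mod_cast this
    simp only [addRightEmbedding_apply, one_pow, mul_one]
    rw [neg_pow (1 - x) s, neg_pow (1 - x) i, pow_add, pow_add]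
    linear_combination -(-1 : ℝ) ^ s * (-1) ^ i * (1 - x) ^ s * (1 - x) ^ i *
      Ring.choose (b + k) s * hch
  rw [h1, Finset.sum_comm]
  refine Finset.sum_congr rfl fun i hi => ?_
  have hik : i + 1 ≤ k + 1 := by simpa using hi
  rw [← Finset.sum_filter]
  have hf : (Finset.range (k + 1)).filter (fun s => s ≤ i) = Finset.range (i + 1) := by
    ext s; simp; omega
  have hv := Ring.add_choose_eq i (Commute.all (b + k) (i : ℝ))
  rw [ring_choose_real_add, Finset.Nat.sum_antidiagonal_eq_sum_range_succ_mk] at hv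
  rw [hf, mul_div_assoc, hv, Finset.mul_sum, Finset.sum_mul]
  refine Finset.sum_congr rfl fun s hs => ?_
  have hsi : s ≤ i := by simpa [Nat.lt_succ_iff] using hs
  rw [Ring.choose_natCast, Nat.choose_symm hsi]
  ring

section BallIntegrals

variable {V : Type*} [NormedAddCommGroup V]

lemma lipschitz_ballWeight {R : ℝ} (hR : 0 < R) (i : ℕ) :
    ∃ K, LipschitzWith K fun y : V => (R ^ 2 - min ‖y‖ R ^ 2) ^ i := by
  have hc : ContDiff ℝ 1 fun r : ℝ => (R ^ 2 - r ^ 2) ^ i := by fun_prop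
  obtain ⟨K, hK⟩ := (hc.locallyLipschitz.locallyLipschitzOn
    (s := Set.Icc 0 R)).exists_lipschitzOnWith_of_compact isCompact_Icc
  refine ⟨K * 1, ?_⟩
  rw [← lipschitzOnWith_univ]
  refine hK.comp (g := fun r : ℝ => (R ^ 2 - r ^ 2) ^ i) (f := fun y : V => min ‖y‖ R)
    (lipschitzOnWith_univ.2 ((lipschitzWith_one_norm (E := V)).min_const R)) fun y _ => ?_
  exact ⟨le_min (norm_nonneg y) hR.le, min_le_right _ _⟩

variable [InnerProductSpace ℝ V]

lemma hasLineDerivAt_ballWeight (R : ℝ) (i : ℕ) (x v : V) :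
    HasLineDerivAt ℝ (fun y : V => (R ^ 2 - ‖y‖ ^ 2) ^ (i + 1))
      (-(2 * (i + 1)) * ((R ^ 2 - ‖x‖ ^ 2) ^ i * inner ℝ x v)) x v := by
  have h1 : HasFDerivAt (fun y : V => ‖y‖ ^ 2) (2 • innerSL ℝ x) x :=
    (hasStrictFDerivAt_norm_sq x).hasFDerivAt
  have h2 := ((h1.const_sub (R ^ 2)).pow (i + 1)).hasLineDerivAt v
  convert h2 using 1
  simp
  ring

variable [FiniteDimensional ℝ V] [MeasurableSpace V] [BorelSpace V]

/-- Integration by parts on a ball against a power of the defining function of the ball. -/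
lemma integral_ballWeight_mul_fderiv {R : ℝ} (hR : 0 < R) (i : ℕ) {q : V → ℝ}
    (hq : ContDiff ℝ 1 q) (v : V) :
    ∫ y in Metric.closedBall (0 : V) R, (R ^ 2 - ‖y‖ ^ 2) ^ (i + 1) * fderiv ℝ q y v =
      2 * (i + 1) * ∫ y in Metric.closedBall (0 : V) R, (R ^ 2 - ‖y‖ ^ 2) ^ i * (inner ℝ y v * q y) := by
  let φ : ContDiffBump (0 : V) := ⟨R, R + 1, hR, by linarith⟩
  obtain ⟨C, hC⟩ := ((φ.contDiff (n := 1)).mul hq).lipschitzWith_of_hasCompactSupport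
    (φ.hasCompactSupport.mul_right) (by simp)
  set f : V → ℝ := fun y => φ y * q y with hf
  set g : V → ℝ := fun y => (R ^ 2 - min ‖y‖ R ^ 2) ^ (i + 1) with hg
  obtain ⟨K, hK⟩ := lipschitz_ballWeight (V := V) hR (i + 1)
  have hgz : ∀ y, R ≤ ‖y‖ → g y = 0 := fun y hy => by simp [hg, min_eq_right hy]
  have hgs : HasCompactSupport g := by
    refine HasCompactSupport.intro (isCompact_closedBall (0 : V) R) fun y hy => hgz y ?_
    simp at hy
    exact hy.le
  have key : ∫ x, lineDeriv ℝ f x v * g x = ∫ x, lineDeriv ℝ g x (-v) * f x :=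
    hC.integral_lineDeriv_mul_eq (μ := volume) hK hgs v
  have hns : ∀ᵐ x : V, x ∉ Metric.sphere (0 : V) R :=
    measure_eq_zero_iff_ae_notMem.1 (Measure.addHaar_sphere_of_ne_zero volume 0 hR.ne')
  rw [← integral_indicator measurableSet_closedBall, ← integral_const_mul,
    ← integral_indicator measurableSet_closedBall]
  have hin : ∀ x : V, ‖x‖ < R → ∀ᶠ y in 𝓝 x, ‖y‖ < R := fun x hx =>
    continuous_norm.continuousAt.eventually (gt_mem_nhds hx)
  convert key using 1
  · refine integral_congr_ae ?_
    filter_upwards [hns] with x hx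
    by_cases hx1 : ‖x‖ ≤ R
    · have hx2 : ‖x‖ < R := lt_of_le_of_ne hx1 (by simpa using hx)
      have hfq : f =ᶠ[𝓝 x] q := by
        filter_upwards [hin x hx2] with y hy
        have : φ y = 1 := φ.one_of_mem_closedBall (by simpa using hy.le)
        simp [hf, this]
      rw [Set.indicator_of_mem (by simpa using hx1), hfq.lineDeriv_eq,
        (hq.differentiable (by simp) x).lineDeriv_eq_fderiv]
      simp [hg, min_eq_left hx1, mul_comm]
    · rw [Set.indicator_of_notMem (by simpa using hx1)]
      simp [hgz x (not_le.1 hx1).le]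
  · refine integral_congr_ae ?_
    filter_upwards [hns] with x hx
    by_cases hx1 : ‖x‖ ≤ R
    · have hx2 : ‖x‖ < R := lt_of_le_of_ne hx1 (by simpa using hx)
      have hgq : g =ᶠ[𝓝 x] fun y => (R ^ 2 - ‖y‖ ^ 2) ^ (i + 1) := by
        filter_upwards [hin x hx2] with y hy
        simp [hg, min_eq_left hy.le]
      have h1 : φ x = 1 := φ.one_of_mem_closedBall (by simpa using hx1)
      rw [Set.indicator_of_mem (by simpa using hx1), hgq.lineDeriv_eq,
        (hasLineDerivAt_ballWeight R i x (-v)).lineDeriv]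
      simp [hf, h1]
      ring
    · rw [Set.indicator_of_notMem (by simpa using hx1)]
      have hgq : g =ᶠ[𝓝 x] fun _ => 0 := by
        filter_upwards [continuous_norm.continuousAt.eventually (lt_mem_nhds (not_le.1 hx1))]
          with y hy
        exact hgz y hy.le
      rw [hgq.lineDeriv_eq, show lineDeriv ℝ (fun _ : V => (0 : ℝ)) x (-v) = 0 by simp [lineDeriv], zero_mul]

lemma measureReal_closedBall_zero {R : ℝ} (hR : 0 < R) :
    volume.real (Metric.closedBall (0 : V) R) =
      Real.pi ^ ((Module.finrank ℝ V : ℝ) / 2) * R ^ Module.finrank ℝ V /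
        Real.Gamma ((Module.finrank ℝ V : ℝ) / 2 + 1) := by
  rcases subsingleton_or_nontrivial V with h | h
  · have h0 : Module.finrank ℝ V = 0 := Module.finrank_zero_of_subsingleton
    have h1 := (stdOrthonormalBasis ℝ V).volume_parallelepiped
    have h2 : parallelepiped (stdOrthonormalBasis ℝ V) = Metric.closedBall (0 : V) R := by
      refine (Set.Nonempty.eq_univ ⟨_, (mem_parallelepiped_iff _ _).2 ⟨0, by simp, rfl⟩⟩).trans
        (Set.Nonempty.eq_univ ⟨0, ?_⟩).symm
      simp [hR.le]
    rw [h2] at h1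
    simp [Measure.real, h1, h0]
  · rw [Measure.real, InnerProductSpace.volume_closedBall, ENNReal.toReal_mul,
      ENNReal.toReal_pow, ENNReal.toReal_ofReal hR.le, ENNReal.toReal_ofReal (by
        have := Real.Gamma_pos_of_pos (show 0 < (Module.finrank ℝ V : ℝ) / 2 + 1 by positivity)
        positivity), Real.sqrt_eq_rpow, ← Real.rpow_mul_natCast Real.pi_pos.le,
      show 1 / 2 * (Module.finrank ℝ V : ℝ) = (Module.finrank ℝ V : ℝ) / 2 by ring]
    ring

lemma integrableOn_closedBall_of_continuous {q : V → ℝ} (hq : Continuous q) (R : ℝ) :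
    IntegrableOn q (Metric.closedBall 0 R) :=
  hq.continuousOn.integrableOn_compact (isCompact_closedBall 0 R)

lemma integral_ballWeight {R : ℝ} (hR : 0 < R) (i : ℕ) :
    ∫ y in Metric.closedBall (0 : V) R, (R ^ 2 - ‖y‖ ^ 2) ^ i =
      Real.pi ^ ((Module.finrank ℝ V : ℝ) / 2) * i.factorial * R ^ (2 * i + Module.finrank ℝ V) /
        Real.Gamma (i + (Module.finrank ℝ V : ℝ) / 2 + 1) := by
  induction i with
  | zero => simp [measureReal_closedBall_zero hR]
  | succ i ih =>
    let b := stdOrthonormalBasis ℝ V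
    have hB := fun a => integral_ballWeight_mul_fderiv hR i
      (q := fun y => inner ℝ y (b a)) (contDiff_id.inner ℝ contDiff_const) (b a)
    have hB1 : ∀ (a) (y : V), fderiv ℝ (fun y => inner ℝ y (b a)) y (b a) = 1 := fun a y => by
      rw [fderiv_inner_apply ℝ (by fun_prop) (by fun_prop)]
      simp
    simp only [hB1, mul_one] at hB
    have hsum := Finset.sum_congr rfl fun a (_ : a ∈ Finset.univ) => hB a
    rw [← Finset.mul_sum, Finset.sum_const, ← integral_finsetSum Finset.univ (f := fun a (y : V) =>
      (R ^ 2 - ‖y‖ ^ 2) ^ i * (inner ℝ y (b a) * inner ℝ y (b a))) fun a _ =>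
      integrableOn_closedBall_of_continuous (by fun_prop) R] at hsum
    have hint : ∀ j, IntegrableOn (fun y : V => (R ^ 2 - ‖y‖ ^ 2) ^ j) (Metric.closedBall 0 R) :=
      fun j => integrableOn_closedBall_of_continuous (by fun_prop) R
    have hr : ∀ y : V, ∑ a, (R ^ 2 - ‖y‖ ^ 2) ^ i * (inner ℝ y (b a) * inner ℝ y (b a)) =
        R ^ 2 * (R ^ 2 - ‖y‖ ^ 2) ^ i - (R ^ 2 - ‖y‖ ^ 2) ^ (i + 1) := fun y => by
      rw [← Finset.mul_sum]
      have : ∑ a, inner ℝ y (b a) * inner ℝ y (b a) = ‖y‖ ^ 2 := by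
        rw [← b.sum_sq_inner_left y]
        exact Finset.sum_congr rfl fun a _ => (sq _).symm
      rw [this]
      ring
    simp only [hr] at hsum
    rw [integral_sub ((hint i).const_mul _) (hint (i + 1)), integral_const_mul, ih] at hsum
    simp only [Finset.card_univ, Fintype.card_fin, nsmul_eq_mul] at hsum
    have hp : 0 < (i : ℝ) + (Module.finrank ℝ V : ℝ) / 2 + 1 := by positivity
    have hG := (Real.Gamma_pos_of_pos hp).ne'
    rw [show ((i + 1 : ℕ) : ℝ) + (Module.finrank ℝ V : ℝ) / 2 + 1 =
      (i + (Module.finrank ℝ V : ℝ) / 2 + 1) + 1 by push_cast; ring, Real.Gamma_add_one hp.ne',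
      eq_div_iff (by positivity), Nat.factorial_succ]
    rw [mul_sub, eq_sub_iff_add_eq, ← add_mul] at hsum
    field_simp at hsum
    push_cast
    ring_nf at hsum ⊢
    linear_combination hsum / 2

end BallIntegrals

lemma IsPolyDeg.contDiff {d m : ℕ} {Y : Esp d → ℝ} (h : IsPolyDeg d m Y) {n : WithTop ℕ∞} :
    ContDiff ℝ n Y := by
  obtain ⟨p, -, hp⟩ := h
  rw [show Y = fun x : Esp d => MvPolynomial.eval (fun i => x i) p from funext hp]
  clear hp
  induction p using MvPolynomial.induction_on with
  | C a => simpa using contDiff_const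
  | add p q hp hq => simpa using hp.add hq
  | mul_X p i hp =>
    simp only [MvPolynomial.eval_mul, MvPolynomial.eval_X]
    exact hp.mul (by fun_prop)

lemma IsPolyDeg.exists_expansion {d m : ℕ} {Y : Esp d → ℝ} (h : IsPolyDeg d m Y) (ξ : Esp d) :
    ∃ c : ℕ → Esp d → ℝ, (∀ l, Continuous (c l)) ∧
      ∀ (s : ℝ) (y : Esp d), Y (s • ξ + y) = ∑ l ∈ Finset.range (m + 1), c l y * s ^ l := by
  obtain ⟨p, hpm, hp⟩ := h
  let P : MvPolynomial (Fin d) ℝ → Esp d → Polynomial ℝ := fun p y =>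
    MvPolynomial.aeval (fun i => Polynomial.C (ξ i) * Polynomial.X + Polynomial.C (y i)) p
  refine ⟨fun l y => (P p y).coeff l, ?_, fun s y => ?_⟩
  · clear hp hpm
    induction p using MvPolynomial.induction_on with
    | C a =>
      intro l
      simp only [P, MvPolynomial.algHom_C]
      exact continuous_const
    | add p q hp hq =>
      intro l
      simp only [P, map_add, Polynomial.coeff_add]
      exact (hp l).add (hq l)
    | mul_X p i hp =>
      intro l
      have hy : Continuous fun y : Esp d => y i := by fun_prop
      have hP : ∀ y, P (p * MvPolynomial.X i) y =
          P p y * (Polynomial.C (ξ i) * Polynomial.X + Polynomial.C (y i)) := fun y => by simp [P]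
      simp only [hP, mul_add, Polynomial.coeff_add, Polynomial.coeff_mul_C, ← mul_assoc]
      rcases l with _ | l
      · simp only [Polynomial.mul_coeff_zero, Polynomial.coeff_X_zero, mul_zero, zero_add]
        exact (hp 0).mul hy
      · simp only [Polynomial.coeff_mul_X, Polynomial.coeff_mul_C]
        exact ((hp l).mul continuous_const).add ((hp (l + 1)).mul hy)
  · have hdeg : (P p y).natDegree < m + 1 := by
      have : (P p y).natDegree ≤ p.totalDegree * 1 :=
        MvPolynomial.aeval_natDegree_le p le_rfl _ fun i => by compute_degree
      omega
    have hev : (P p y).eval s = Y (s • ξ + y) := by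
      simp only [P]
      rw [hp, ← Polynomial.coe_evalRingHom, MvPolynomial.aeval_def, MvPolynomial.hom_eval₂,
        MvPolynomial.eval, MvPolynomial.coe_eval₂Hom]
      congr 1
      · ext a
        simp [Polynomial.algebraMap_eq]
      · ext i
        simp only [Polynomial.coe_evalRingHom, Polynomial.eval_add, Polynomial.eval_mul,
          Polynomial.eval_C, Polynomial.eval_X, PiLp.add_apply, PiLp.smul_apply, smul_eq_mul]
        ring
    rw [← hev, Polynomial.eval_eq_sum_range' hdeg]

lemma IsHomogeneousDeg.fderiv_self {d m : ℕ} {Y : Esp d → ℝ} (h : IsHomogeneousDeg m Y)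
    (hY : Differentiable ℝ Y) (x : Esp d) : fderiv ℝ Y x x = m * Y x := by
  have h1 : HasDerivAt (fun c : ℝ => Y (c • x)) (fderiv ℝ Y x x) 1 := by
    have h2 : HasDerivAt (fun c : ℝ => c • x) x 1 := by
      simpa using (hasDerivAt_id (1 : ℝ)).smul_const x
    have h3 : HasFDerivAt Y (fderiv ℝ Y x) ((1 : ℝ) • x) := by
      rw [one_smul]
      exact (hY x).hasFDerivAt
    exact h3.comp_hasDerivAt 1 h2
  have h2 : HasDerivAt (fun c : ℝ => Y (c • x)) (m * Y x) 1 := by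
    simp only [h _ x]
    simpa using (hasDerivAt_pow m (1 : ℝ)).mul_const (Y x)
  exact h1.unique h2

lemma exists_orthonormalBasis_option {d : ℕ} {ξ : Esp d} (hξ : ‖ξ‖ = 1) (hd : 1 ≤ d) :
    Module.finrank ℝ (ℝ ∙ ξ)ᗮ = d - 1 ∧
    ∃ b : OrthonormalBasis (Option (Fin (Module.finrank ℝ (ℝ ∙ ξ)ᗮ))) ℝ (Esp d),
      b none = ξ ∧ ∀ a, b (some a) = stdOrthonormalBasis ℝ (ℝ ∙ ξ)ᗮ a := by
  have hne : ξ ≠ 0 := by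
    rintro rfl
    simp at hξ
  have hfd : Fact (Module.finrank ℝ (Esp d) = (d - 1) + 1) := ⟨by simp; omega⟩
  have hfr : Module.finrank ℝ (ℝ ∙ ξ)ᗮ = d - 1 := Submodule.finrank_orthogonal_span_singleton hne
  let v := stdOrthonormalBasis ℝ (ℝ ∙ ξ)ᗮ
  let f : Option (Fin (Module.finrank ℝ (ℝ ∙ ξ)ᗮ)) → Esp d := fun o => o.elim ξ fun a => v a
  have hperp : ∀ a, inner ℝ ξ (v a : Esp d) = 0 := fun a =>
    Submodule.mem_orthogonal_singleton_iff_inner_right.1 (v a).2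
  have hf : Orthonormal ℝ f := by
    rw [orthonormal_iff_ite]
    rintro (_ | a) (_ | b)
    · simp [f, hξ]
    · simp [f, hperp]
    · simp [f, real_inner_comm, hperp]
    · have := orthonormal_iff_ite.1 v.orthonormal a b
      simpa [f] using this
  have hspan : ⊤ ≤ Submodule.span ℝ (Set.range f) := by
    rw [hf.linearIndependent.span_eq_top_of_card_eq_finrank']
    simp [hfr]
    omega
  exact ⟨hfr, OrthonormalBasis.mk hf hspan, by simp [f], by simp [f, v]⟩

lemma IsHarmonicFn.fderiv_fderiv_eq {d : ℕ} {Y : Esp d → ℝ} (h : IsHarmonicFn Y)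
    {ξ : Esp d} (hξ : ‖ξ‖ = 1) (hd : 1 ≤ d) (x : Esp d) :
    fderiv ℝ (fderiv ℝ Y) x ξ ξ = -∑ a, fderiv ℝ (fderiv ℝ Y) x
      (stdOrthonormalBasis ℝ (ℝ ∙ ξ)ᗮ a) (stdOrthonormalBasis ℝ (ℝ ∙ ξ)ᗮ a) := by
  obtain ⟨-, b, hb1, hb2⟩ := exists_orthonormalBasis_option hξ hd
  have h1 := congrFun (InnerProductSpace.laplacian_eq_iteratedFDeriv_orthonormalBasis Y b) x
  have h2 := congrFun (InnerProductSpace.laplacian_eq_iteratedFDeriv_orthonormalBasis Y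
    (EuclideanSpace.basisFun (Fin d) ℝ)) x
  have h3 := h x
  simp only [EuclideanSpace.basisFun_apply] at h2
  rw [h3] at h2
  rw [h2, Fintype.sum_option] at h1
  simp only [iteratedFDeriv_two_apply, hb1, hb2, Matrix.cons_val_zero, Matrix.cons_val_one] at h1
  linarith

section Expansion

variable {d m : ℕ} {Y : Esp d → ℝ} {ξ : Esp d} {c : ℕ → Esp d → ℝ}

lemma IsHomogeneousDeg.top_coeff (hYh : IsHomogeneousDeg m Y) (hYc : Continuous Y)
    (hc : ∀ (s : ℝ) (y : Esp d), Y (s • ξ + y) = ∑ l ∈ Finset.range (m + 1), c l y * s ^ l)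
    (y : Esp d) : c m y = Y ξ := by
  have h1 : (fun τ : ℝ => Y (ξ + τ • y)) =
      fun τ : ℝ => ∑ l ∈ Finset.range (m + 1), c l y * τ ^ (m - l) := by
    refine Continuous.ext_on (dense_compl_singleton (0 : ℝ)) (by fun_prop) (by fun_prop) ?_
    intro τ (hτ : τ ≠ 0)
    have h2 : ξ + τ • y = τ • (τ⁻¹ • ξ + y) := by
      rw [smul_add, smul_smul, mul_inv_cancel₀ hτ, one_smul]
    simp only []
    rw [h2, hYh, hc, Finset.mul_sum]
    refine Finset.sum_congr rfl fun l hl => ?_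
    have hlm : l ≤ m := by simpa [Nat.lt_succ_iff] using hl
    rw [← Nat.sub_add_cancel hlm, pow_add, Nat.add_sub_cancel, inv_pow]
    have := pow_ne_zero l hτ
    field_simp
  have h3 := congrFun h1 0
  simp only [zero_smul, add_zero] at h3
  rw [h3, Finset.sum_range_succ, Finset.sum_eq_zero]
  · simp
  · intro l hl
    have : m - l ≠ 0 := by
      have := Finset.mem_range.1 hl
      omega
    simp [this]

lemma fderiv_apply_expansion (hY : Differentiable ℝ Y)
    (hc : ∀ (s : ℝ) (y : Esp d), Y (s • ξ + y) = ∑ l ∈ Finset.range (m + 1), c l y * s ^ l)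
    (s : ℝ) (y : Esp d) :
    fderiv ℝ Y (s • ξ + y) ξ = ∑ l ∈ Finset.range (m + 1), c l y * (l * s ^ (l - 1)) := by
  have h0 : HasDerivAt (fun s : ℝ => s • ξ + y) ξ s := by
    simpa using ((hasDerivAt_id s).smul_const ξ).add_const y
  have h1 : HasDerivAt (fun s : ℝ => Y (s • ξ + y)) (fderiv ℝ Y (s • ξ + y) ξ) s :=
    (hY (s • ξ + y)).hasFDerivAt.comp_hasDerivAt s h0
  simp only [hc] at h1
  exact h1.unique (HasDerivAt.fun_sum fun l _ => (hasDerivAt_pow l s).const_mul (c l y))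

lemma fderiv_fderiv_apply_expansion (hY : ContDiff ℝ 2 Y)
    (hc : ∀ (s : ℝ) (y : Esp d), Y (s • ξ + y) = ∑ l ∈ Finset.range (m + 1), c l y * s ^ l)
    (s : ℝ) (y : Esp d) :
    fderiv ℝ (fderiv ℝ Y) (s • ξ + y) ξ ξ =
      ∑ l ∈ Finset.range (m + 1), c l y * (l * ((l - 1 : ℕ) * s ^ (l - 1 - 1))) := by
  have h0 : HasDerivAt (fun s : ℝ => s • ξ + y) ξ s := by
    simpa using ((hasDerivAt_id s).smul_const ξ).add_const y
  have hF : Differentiable ℝ (fderiv ℝ Y) :=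
    (hY.fderiv_right (m := 1) le_rfl).differentiable one_ne_zero
  have h1 : HasDerivAt (fun s : ℝ => fderiv ℝ Y (s • ξ + y) ξ)
      (fderiv ℝ (fderiv ℝ Y) (s • ξ + y) ξ ξ) s := by
    have h2 : HasDerivAt (fun s : ℝ => fderiv ℝ Y (s • ξ + y))
        (fderiv ℝ (fderiv ℝ Y) (s • ξ + y) ξ) s :=
      (hF (s • ξ + y)).hasFDerivAt.comp_hasDerivAt s h0
    simpa using h2.clm_apply (hasDerivAt_const s ξ)
  simp only [fderiv_apply_expansion (hY.differentiable two_ne_zero) hc] at h1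
  exact h1.unique (HasDerivAt.fun_sum fun l _ =>
    ((hasDerivAt_pow (l - 1) s).const_mul (l : ℝ)).const_mul (c l y))

lemma IsSphHarm.integral_relation (hY : IsSphHarm d m Y) (hξ : ‖ξ‖ = 1) (hd : 1 ≤ d)
    {R : ℝ} (hR : 0 < R) (i : ℕ) (s : ℝ) :
    ∫ y in Metric.closedBall (0 : (ℝ ∙ ξ)ᗮ) R, (R ^ 2 - ‖y‖ ^ 2) ^ (i + 1) *
        fderiv ℝ (fderiv ℝ Y) (s • ξ + y) ξ ξ =
      -(2 * (i + 1)) * ∫ y in Metric.closedBall (0 : (ℝ ∙ ξ)ᗮ) R, (R ^ 2 - ‖y‖ ^ 2) ^ i *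
        (m * Y (s • ξ + y) - s * fderiv ℝ Y (s • ξ + y) ξ) := by
  obtain ⟨hYp, hYh, hYl⟩ := hY
  have hY2 : ContDiff ℝ 2 Y := hYp.contDiff
  have hF1 : ContDiff ℝ 1 (fderiv ℝ Y) := hY2.fderiv_right le_rfl
  have hF2 : Continuous (fderiv ℝ (fderiv ℝ Y)) := hF1.continuous_fderiv one_ne_zero
  let v := stdOrthonormalBasis ℝ (ℝ ∙ ξ)ᗮ
  let ι : (ℝ ∙ ξ)ᗮ → Esp d := fun y => s • ξ + y
  have hι : ContDiff ℝ 1 ι := contDiff_const.add (ℝ ∙ ξ)ᗮ.subtypeL.contDiff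
  have hιd : ∀ y, HasFDerivAt ι (ℝ ∙ ξ)ᗮ.subtypeL y := fun y =>
    (ℝ ∙ ξ)ᗮ.subtypeL.hasFDerivAt.const_add (s • ξ)
  have hB : ∀ a, _ := fun a => integral_ballWeight_mul_fderiv hR i
    (q := fun y => fderiv ℝ Y (ι y) (v a)) ((hF1.comp hι).clm_apply contDiff_const) (v a)
  have hfd : ∀ a y, fderiv ℝ (fun y => fderiv ℝ Y (ι y) (v a)) y (v a) =
      fderiv ℝ (fderiv ℝ Y) (ι y) (v a) (v a) := fun a y => by
    have h1 := (((hF1.differentiable one_ne_zero) (ι y)).hasFDerivAt.comp y (hιd y)).clm_apply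
      (hasFDerivAt_const (v a : Esp d) y)
    have h2 := h1.fderiv
    simp only [Function.comp_apply] at h2
    rw [h2]
    simp
  simp only [hfd] at hB
  have hsum := Finset.sum_congr rfl fun a (_ : a ∈ Finset.univ) => hB a
  rw [← Finset.mul_sum, ← integral_finsetSum Finset.univ (f := fun a (y : (ℝ ∙ ξ)ᗮ) =>
      (R ^ 2 - ‖y‖ ^ 2) ^ (i + 1) * fderiv ℝ (fderiv ℝ Y) (ι y) (v a) (v a)) fun a _ =>
      integrableOn_closedBall_of_continuous (by fun_prop) R,
    ← integral_finsetSum Finset.univ (f := fun a (y : (ℝ ∙ ξ)ᗮ) =>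
      (R ^ 2 - ‖y‖ ^ 2) ^ i * (inner ℝ y (v a) * fderiv ℝ Y (ι y) (v a))) fun a _ =>
      integrableOn_closedBall_of_continuous (by fun_prop) R] at hsum
  have hl : ∀ y, ∑ a, (R ^ 2 - ‖y‖ ^ 2) ^ (i + 1) * fderiv ℝ (fderiv ℝ Y) (ι y) (v a) (v a) =
      -((R ^ 2 - ‖y‖ ^ 2) ^ (i + 1) * fderiv ℝ (fderiv ℝ Y) (ι y) ξ ξ) := fun y => by
    rw [hYl.fderiv_fderiv_eq hξ hd, ← Finset.mul_sum]
    ring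
  have hr : ∀ y, ∑ a, (R ^ 2 - ‖y‖ ^ 2) ^ i * (inner ℝ y (v a) * fderiv ℝ Y (ι y) (v a)) =
      (R ^ 2 - ‖y‖ ^ 2) ^ i * (m * Y (ι y) - s * fderiv ℝ Y (ι y) ξ) := fun y => by
    rw [← Finset.mul_sum]
    congr 1
    have h1 : (y : Esp d) = ∑ a, inner ℝ y (v a) • (v a : Esp d) := by
      conv_lhs => rw [← v.sum_repr' y]
      simp only [Submodule.coe_sum, Submodule.coe_smul, real_inner_comm]
    have h2 := hYh.fderiv_self (hY2.differentiable two_ne_zero) (ι y)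
    have h3 : fderiv ℝ Y (ι y) (y : Esp d) = ∑ a, inner ℝ y (v a) * fderiv ℝ Y (ι y) (v a) := by
      conv_lhs => rw [h1]
      simp only [map_sum, map_smul, smul_eq_mul]
    rw [← h3, ← h2]
    have h4 : fderiv ℝ Y (ι y) (ι y) = s * fderiv ℝ Y (ι y) ξ + fderiv ℝ Y (ι y) y := by
      conv_lhs => rw [show ι y = s • ξ + (y : Esp d) from rfl]
      simp only [map_add, map_smul, smul_eq_mul, ι]
    rw [h4]
    ring
  simp only [hl, hr, integral_neg] at hsum
  simp only [ι] at hsum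
  linarith

end Expansion

lemma coeff_eq_of_forall_sum_eq (m : ℕ) (A B : ℕ → ℝ) (D : ℝ)
    (h : ∀ s : ℝ, ∑ l ∈ Finset.range (m + 1), A l * (l * ((l - 1 : ℕ) * s ^ (l - 1 - 1))) =
      D * ∑ l ∈ Finset.range (m + 1), B l * ((m - l) * s ^ l)) :
    (∀ r, r + 2 ≤ m → A (r + 2) * ((r + 2) * (r + 1)) = D * (B r * (m - r))) ∧
      ∀ r, r + 1 = m → D * B r = 0 := by
  have hp : ∑ l ∈ Finset.range (m + 1), Polynomial.C (A l * (l * (l - 1 : ℕ))) *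
      (Polynomial.X : Polynomial ℝ) ^ (l - 1 - 1) = Polynomial.C D *
        ∑ l ∈ Finset.range (m + 1), Polynomial.C (B l * (m - l)) * Polynomial.X ^ l := by
    refine Polynomial.funext fun s => ?_
    simp only [Polynomial.eval_finsetSum, Polynomial.eval_mul, Polynomial.eval_C,
      Polynomial.eval_pow, Polynomial.eval_X]
    simpa only [mul_assoc] using h s
  have hco := fun r => congrArg (fun p => Polynomial.coeff p r) hp
  simp only [Polynomial.finsetSum_coeff, Polynomial.coeff_C_mul, Polynomial.coeff_X_pow,
    mul_ite, mul_one, mul_zero] at hco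
  have hR : ∀ r, r ≤ m → ∑ l ∈ Finset.range (m + 1), (if r = l then B l * ((m : ℝ) - l) else 0) =
      B r * (m - r) := fun r hr => by
    rw [Finset.sum_ite_eq, if_pos (by simpa [Nat.lt_succ_iff] using hr)]
  constructor
  · intro r hr
    have h1 := hco r
    rw [hR r (by omega), Finset.sum_eq_single_of_mem (r + 2) (by simp; omega)] at h1
    · rw [← h1]
      simp
    · intro l _ hl
      rcases l with _ | _ | l
      · simp
      · simp
      · rw [if_neg (by omega)]
  · intro r hr
    have h1 := hco r
    rw [hR r (by omega), Finset.sum_eq_zero] at h1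
    · have : (m : ℝ) - r = 1 := by rw [← hr]; push_cast; ring
      rw [this, mul_one] at h1
      exact h1.symm
    · intro l hl
      have := Finset.mem_range.1 hl
      rcases l with _ | _ | l
      · simp
      · simp
      · rw [if_neg (by omega)]

/-- Integral of a solid spherical harmonic against a power weight over the section of a ball by a
hyperplane. -/
lemma IsSphHarm.integral_ballWeight_mul {d m : ℕ} {Y : Esp d → ℝ} {ξ : Esp d}
    (hY : IsSphHarm d m Y) (hξ : ‖ξ‖ = 1) (hd : 1 ≤ d) {R : ℝ} (hR : 0 < R) (i : ℕ) (s : ℝ) :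
    ∫ y in Metric.closedBall (0 : (ℝ ∙ ξ)ᗮ) R, (R ^ 2 - ‖y‖ ^ 2) ^ i * Y (s • ξ + y) =
      ∑ j ∈ Finset.range (m / 2 + 1), Y ξ * ((-1) ^ j * m.factorial /
        ((m - 2 * j).factorial * 4 ^ j * j.factorial)) *
        (Real.pi ^ ((Module.finrank ℝ (ℝ ∙ ξ)ᗮ : ℝ) / 2) * i.factorial *
          R ^ (2 * (i + j) + Module.finrank ℝ (ℝ ∙ ξ)ᗮ) /
            Real.Gamma ((i + j : ℕ) + (Module.finrank ℝ (ℝ ∙ ξ)ᗮ : ℝ) / 2 + 1)) *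
        s ^ (m - 2 * j) := by
  have hY2 : ContDiff ℝ 2 Y := hY.1.contDiff
  have hYd := hY2.differentiable two_ne_zero
  obtain ⟨c, hcc, hc⟩ := hY.1.exists_expansion ξ
  have htop := hY.2.1.top_coeff hY2.continuous hc
  let K : ℕ → ℕ → ℝ := fun i l =>
    ∫ y in Metric.closedBall (0 : (ℝ ∙ ξ)ᗮ) R, (R ^ 2 - ‖y‖ ^ 2) ^ i * c l y
  have hK : ∀ (i : ℕ) (α : ℕ → ℝ), ∫ y in Metric.closedBall (0 : (ℝ ∙ ξ)ᗮ) R,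
      (R ^ 2 - ‖y‖ ^ 2) ^ i * ∑ l ∈ Finset.range (m + 1), c l y * α l =
        ∑ l ∈ Finset.range (m + 1), K i l * α l := fun i α => by
    simp only [Finset.mul_sum, ← mul_assoc]
    rw [integral_finsetSum _ (f := fun l (y : (ℝ ∙ ξ)ᗮ) =>
      (R ^ 2 - ‖y‖ ^ 2) ^ i * c l y * α l) fun l _ =>
        integrableOn_closedBall_of_continuous (q := fun y : (ℝ ∙ ξ)ᗮ =>
          (R ^ 2 - ‖y‖ ^ 2) ^ i * c l y * α l) (by have := hcc l; fun_prop) R]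
    simp only [integral_mul_const, K]
  have hrel : ∀ (i : ℕ) (s : ℝ),
      ∑ l ∈ Finset.range (m + 1), K (i + 1) l * (l * ((l - 1 : ℕ) * s ^ (l - 1 - 1))) =
        -(2 * (i + 1)) * ∑ l ∈ Finset.range (m + 1), K i l * ((m - l) * s ^ l) := fun i s => by
    have h := hY.integral_relation hξ hd hR i s
    rw [← hK, ← hK]
    simp only [fderiv_fderiv_apply_expansion hY2 hc, fderiv_apply_expansion hYd hc, hc] at h
    rw [h]
    congr 2
    ext y
    congr 1
    rw [Finset.mul_sum, Finset.mul_sum, ← Finset.sum_sub_distrib]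
    refine Finset.sum_congr rfl fun l _ => ?_
    rcases l with _ | l
    · simp
      ring
    · simp only [Nat.add_sub_cancel]
      ring
  have hco := fun i => coeff_eq_of_forall_sum_eq m (K (i + 1)) (K i) _ (hrel i)
  have hne : ∀ i : ℕ, -(2 * ((i : ℝ) + 1)) ≠ 0 := fun i => neg_ne_zero.2 (by positivity)
  have hodd : ∀ j i, 2 * j + 1 ≤ m → K i (m - (2 * j + 1)) = 0 := by
    intro j
    induction j with
    | zero =>
      intro i hj
      exact (mul_eq_zero.1 ((hco i).2 (m - 1) (by omega))).resolve_left (hne i)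
    | succ j ih =>
      intro i hj
      have h1 := (hco i).1 (m - (2 * (j + 1) + 1)) (by omega)
      rw [show m - (2 * (j + 1) + 1) + 2 = m - (2 * j + 1) by omega, ih (i + 1) (by omega),
        zero_mul] at h1
      have h2 : (m : ℝ) - (m - (2 * (j + 1) + 1) : ℕ) ≠ 0 := by
        rw [Nat.cast_sub hj, sub_sub_cancel]
        positivity
      exact (mul_eq_zero.1 ((mul_eq_zero.1 h1.symm).resolve_left (hne i))).resolve_right h2
  have heven : ∀ j i, 2 * j ≤ m → K i (m - 2 * j) = Y ξ * ((-1) ^ j * m.factorial /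
        ((m - 2 * j).factorial * 4 ^ j * j.factorial)) *
        (Real.pi ^ ((Module.finrank ℝ (ℝ ∙ ξ)ᗮ : ℝ) / 2) * i.factorial *
          R ^ (2 * (i + j) + Module.finrank ℝ (ℝ ∙ ξ)ᗮ) /
            Real.Gamma ((i + j : ℕ) + (Module.finrank ℝ (ℝ ∙ ξ)ᗮ : ℝ) / 2 + 1)) := by
    intro j
    induction j with
    | zero =>
      intro i _
      have hf : (m.factorial : ℝ) ≠ 0 := by exact_mod_cast m.factorial_ne_zero
      simp only [K, mul_zero, Nat.sub_zero, htop, integral_mul_const, integral_ballWeight hR i]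
      simp [hf, mul_comm]
    | succ j ih =>
      intro i hj
      have h1 := (hco i).1 (m - 2 * (j + 1)) (by omega)
      rw [show m - 2 * (j + 1) + 2 = m - 2 * j by omega, ih (i + 1) (by omega)] at h1
      obtain ⟨r, hr⟩ : ∃ r, m = r + 2 * (j + 1) := ⟨m - 2 * (j + 1), by omega⟩
      have e1 : m - 2 * (j + 1) = r := by omega
      have e2 : m - 2 * j = r + 2 := by omega
      have e3 : (m : ℝ) - r = 2 * (j + 1) := by rw [hr]; push_cast; ring
      rw [e1, e2, e3] at h1
      rw [e1]
      have f1 := Nat.cast_ne_zero (R := ℝ).2 r.factorial_ne_zero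
      have f2 := Nat.cast_ne_zero (R := ℝ).2 j.factorial_ne_zero
      have f3 : (j : ℝ) + 1 ≠ 0 := by positivity
      have f4 : (i : ℝ) + 1 ≠ 0 := by positivity
      have f5 : (r : ℝ) + 1 ≠ 0 := by positivity
      have f6 : (r : ℝ) + 2 ≠ 0 := by positivity
      rw [show i + 1 + j = i + (j + 1) by ring] at h1
      generalize Real.pi ^ ((Module.finrank ℝ (ℝ ∙ ξ)ᗮ : ℝ) / 2) = P at h1 ⊢
      generalize R ^ (2 * (i + (j + 1)) + Module.finrank ℝ (ℝ ∙ ξ)ᗮ) = Q at h1 ⊢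
      generalize Real.Gamma _ = G at h1 ⊢
      have h2 : K i r = -(Y ξ * ((-1) ^ j * m.factorial /
        ((r + 2).factorial * 4 ^ j * j.factorial)) * (P * (i + 1).factorial * Q / G) *
          ((r + 2) * (r + 1)) / (2 * (i + 1) * (2 * (j + 1)))) := by
        rw [eq_neg_iff_add_eq_zero, ← eq_neg_iff_add_eq_zero, h1]
        field_simp
      rw [h2, Nat.factorial_succ (r + 1), Nat.factorial_succ r, Nat.factorial_succ i,
        Nat.factorial_succ j]
      push_cast
      rw [show (r : ℝ) + 1 + 1 = r + 2 by ring]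
      field_simp
      ring
  simp only [hc]
  rw [hK]
  symm
  refine Finset.sum_of_injOn (fun j => m - 2 * j) ?_ ?_ ?_ ?_
  · intro a ha b hb hab
    simp at ha hb hab
    omega
  · intro a ha
    simp
  · intro l hl hl2
    simp only [Finset.mem_range] at hl
    have : K i l = 0 := by
      by_contra hne0
      apply hl2
      rcases Nat.even_or_odd' (m - l) with ⟨j, hj | hj⟩
      · exact ⟨j, by simp; omega, by simp; omega⟩
      · exfalso
        apply hne0
        have := hodd j i (by omega)
        rwa [← hj, Nat.sub_sub_self (by omega)] at this
    simp [this]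
  · intro j hj
    rw [heven j i (by simp at hj; omega)]

lemma Gamma_nat_add_eq_poch {a : ℝ} (ha : 0 < a) (p : ℕ) :
    Real.Gamma (p + a) = Real.Gamma a * poch a p := by
  induction p with
  | zero => simp [poch]
  | succ p ih =>
    have : (p : ℝ) + a ≠ 0 := by positivity
    rw [poch_succ, show ((p + 1 : ℕ) : ℝ) + a = p + a + 1 by push_cast; ring,
      Real.Gamma_add_one this, ih]
    ring

lemma poch_one (k : ℕ) : poch 1 k = k.factorial := by
  induction k with
  | zero => simp [poch]
  | succ k ih =>
    rw [poch_succ, ih, Nat.factorial_succ]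
    push_cast
    ring

lemma norm_sq_smul_add {d : ℕ} {ξ : Esp d} (hξ : ‖ξ‖ = 1) (t : ℝ) (y : (ℝ ∙ ξ)ᗮ) :
    ‖t • ξ + (y : Esp d)‖ ^ 2 = t ^ 2 + ‖y‖ ^ 2 := by
  have h : inner ℝ ξ (y : Esp d) = 0 :=
    Submodule.mem_orthogonal_singleton_iff_inner_right.1 y.2
  rw [norm_add_sq_real, inner_smul_left, h, norm_smul, hξ]
  simp

lemma setOf_smul_add_mem_closedBall {d : ℕ} {ξ : Esp d} (hξ : ‖ξ‖ = 1) {t R : ℝ} (hR : 0 ≤ R)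
    (ht : R ^ 2 = 1 - t ^ 2) :
    {y : (ℝ ∙ ξ)ᗮ | t • ξ + (y : Esp d) ∈ Metric.closedBall (0 : Esp d) 1} =
      Metric.closedBall 0 R := by
  ext y
  have h := norm_sq_smul_add hξ t y
  rw [Set.mem_ofPred_eq, mem_closedBall_zero_iff, mem_closedBall_zero_iff,
    ← sq_le_sq₀ (norm_nonneg _) zero_le_one, ← sq_le_sq₀ (norm_nonneg _) hR, h, ht]
  constructor <;> intro h <;> linarith

/-- The Radon transform of the product of a spherical harmonic and a polynomial of Jacobi type. -/
lemma IsSphHarm.integral_section {d m : ℕ} {Y : Esp d → ℝ} {ξ : Esp d}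
    (hY : IsSphHarm d m Y) (hξ : ‖ξ‖ = 1) (hd : 1 ≤ d) (k : ℕ) {t : ℝ}
    (ht : t ∈ Set.Icc (-1 : ℝ) 1) :
    ∫ y in {y : (ℝ ∙ ξ)ᗮ | t • ξ + (y : Esp d) ∈ Metric.closedBall (0 : Esp d) 1},
      (∑ i ∈ Finset.range (k + 1), (-1) ^ i * k.choose i *
        poch (k + m + ((d : ℝ) - 1) / 2 + 1 / 2) i / i.factorial *
          (1 - ‖t • ξ + (y : Esp d)‖ ^ 2) ^ i) * Y (t • ξ + y) =
      Real.pi ^ (((d : ℝ) - 1) / 2) / Real.Gamma (((d : ℝ) - 1) / 2 + 1) *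
        (1 - t ^ 2) ^ (((d : ℝ) - 1) / 2) * ((m + 2 * k).factorial / poch d (m + 2 * k) *
          gegen ((d : ℝ) / 2) (m + 2 * k) t) * Y ξ := by
  obtain ⟨hfr, -⟩ := exists_orthonormalBasis_option hξ hd
  have he : ((Module.finrank ℝ (ℝ ∙ ξ)ᗮ : ℕ) : ℝ) = d - 1 := by
    rw [hfr, Nat.cast_sub hd, Nat.cast_one]
  have hd1 : (1 : ℝ) ≤ d := by exact_mod_cast hd
  have hν : 0 ≤ ((d : ℝ) - 1) / 2 := by linarith
  have hmix := sum_mixedCoeff (((d : ℝ) - 1) / 2) hν m k t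
  rw [show 2 * (((d : ℝ) - 1) / 2) + 1 = d by ring,
    show ((d : ℝ) - 1) / 2 + 1 / 2 = d / 2 by ring] at hmix
  rw [← hmix]
  have ht1 : 0 ≤ 1 - t ^ 2 := by nlinarith [ht.1, ht.2]
  have hYc : Continuous Y := hY.1.contDiff (n := 0).continuous
  have hnorm := norm_sq_smul_add hξ t
  rcases ht1.lt_or_eq with hw | hw
  · obtain ⟨R, hR, hRt⟩ : ∃ R : ℝ, 0 < R ∧ R ^ 2 = 1 - t ^ 2 :=
      ⟨√(1 - t ^ 2), Real.sqrt_pos.2 hw, Real.sq_sqrt hw.le⟩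
    rw [setOf_smul_add_mem_closedBall hξ hR.le hRt]
    have hu : ∀ y : (ℝ ∙ ξ)ᗮ, 1 - ‖t • ξ + (y : Esp d)‖ ^ 2 = R ^ 2 - ‖y‖ ^ 2 := fun y => by
      rw [hnorm, hRt]
      ring
    simp only [hu, Finset.sum_mul]
    rw [integral_finsetSum _ fun i _ =>
      integrableOn_closedBall_of_continuous (q := fun y : (ℝ ∙ ξ)ᗮ => (-1) ^ i * k.choose i *
        poch (k + m + ((d : ℝ) - 1) / 2 + 1 / 2) i / i.factorial *
          (R ^ 2 - ‖y‖ ^ 2) ^ i * Y (t • ξ + y)) (by fun_prop) R]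
    simp only [mul_assoc _ (_ ^ _) (Y _), integral_const_mul,
      hY.integral_ballWeight_mul hξ hd hR, Finset.mul_sum, Finset.sum_mul]
    refine Finset.sum_congr rfl fun i _ => Finset.sum_congr rfl fun j _ => ?_
    have hRe : R ^ Module.finrank ℝ (ℝ ∙ ξ)ᗮ = (1 - t ^ 2) ^ (((d : ℝ) - 1) / 2) := by
      rw [← hRt, ← Real.rpow_natCast_mul hR.le, ← Real.rpow_natCast, he]
      congr 1
      push_cast
      ring
    have hG := (Real.Gamma_pos_of_pos (show 0 < ((d : ℝ) - 1) / 2 + 1 by linarith)).ne'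
    have hP := (poch_pos (show 0 < ((d : ℝ) - 1) / 2 + 1 by linarith) (i + j)).ne'
    rw [pow_add, pow_mul, hRt, hRe, he, add_assoc _ (((d : ℝ) - 1) / 2) 1,
      Gamma_nat_add_eq_poch (by linarith), mixedCoeff]
    have f1 := Nat.cast_ne_zero (R := ℝ).2 i.factorial_ne_zero
    have f2 := Nat.cast_ne_zero (R := ℝ).2 j.factorial_ne_zero
    have f3 := Nat.cast_ne_zero (R := ℝ).2 (m - 2 * j).factorial_ne_zero
    field_simp
    ring
  · rcases Nat.lt_or_ge 1 d with hd2 | hd2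
    · have h0 : volume (Metric.closedBall (0 : (ℝ ∙ ξ)ᗮ) 0) = 0 := by
        rw [Measure.addHaar_closedBall _ _ le_rfl, zero_pow (by omega)]
        simp
      rw [setOf_smul_add_mem_closedBall hξ le_rfl (by rw [← hw]; simp),
        Measure.restrict_eq_zero.2 h0, integral_zero_measure, ← hw, Real.zero_rpow]
      · simp
      · have : (1 : ℝ) < d := by exact_mod_cast hd2
        linarith
    · obtain rfl : d = 1 := le_antisymm hd2 hd
      have hsub : Subsingleton (ℝ ∙ ξ)ᗮ := by
        rw [← Module.finrank_zero_iff (R := ℝ), hfr]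
      have hset : {y : (ℝ ∙ ξ)ᗮ | t • ξ + (y : Esp 1) ∈ Metric.closedBall (0 : Esp 1) 1} =
          Metric.closedBall 0 1 := by
        rw [setOf_smul_add_mem_closedBall hξ le_rfl (by rw [← hw]; simp)]
        ext y
        simp [Subsingleton.elim y 0]
      have hy : ∀ y : (ℝ ∙ ξ)ᗮ, y = 0 := fun y => Subsingleton.elim y 0
      have hvol := measureReal_closedBall_zero (V := (ℝ ∙ ξ)ᗮ) one_pos
      rw [hset]
      have hx : ∀ y : (ℝ ∙ ξ)ᗮ, t • ξ + (y : Esp 1) = t • ξ := fun y => by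
        rw [hy y]
        simp
      simp only [hx]
      rw [setIntegral_const, hvol, hfr, hY.2.1, norm_smul, hξ, ← hw,
        Finset.sum_eq_single_of_mem 0 (by simp), Finset.sum_eq_single_of_mem 0 (by simp),
        Finset.sum_eq_single_of_mem 0 (by simp)]
      · have f3 := Nat.cast_ne_zero (R := ℝ).2 m.factorial_ne_zero
        simp [mixedCoeff, poch, f3]
      · intro j _ hj
        simp [hj]
      · intro i _ hi
        exact Finset.sum_eq_zero fun j _ => by simp [hi]
      · intro i _ hi
        simp [hi, ← hw]

lemma hnk_mul_sqrt_hJacobi {d n k : ℕ} (hd : 1 ≤ d) (hk : 2 * k ≤ n) :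
    hnk d n k * √(hJacobi 0 ((n : ℝ) - 2 * k + ((d : ℝ) - 2) / 2) k) =
      √(((d : ℝ) / 2) / (n + d / 2)) := by
  obtain ⟨m, rfl⟩ : ∃ m, n = m + 2 * k := ⟨n - 2 * k, by omega⟩
  have hd1 : (1 : ℝ) ≤ d := by exact_mod_cast hd
  have hm : (0 : ℝ) ≤ m := m.cast_nonneg
  have hk0 : (0 : ℝ) ≤ k := k.cast_nonneg
  have e1 : ((m + 2 * k : ℕ) : ℝ) - 2 * k = m := by push_cast; ring
  have hd2 : (0 : ℝ) < (d : ℝ) / 2 := by linarith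
  have hmd : 0 < (m : ℝ) + d / 2 := by linarith
  have hG1 := (Real.Gamma_pos_of_pos hd2).ne'
  have hG2 := (Real.Gamma_pos_of_pos hmd).ne'
  have hnk0 : hnk d (m + 2 * k) k = √(((d : ℝ) / 2) / (m + d / 2)) := by
    rw [hnk, e1, show ((d : ℝ) + 2) / 2 = d / 2 + 1 by ring, Real.Gamma_add_one hd2.ne',
      ← add_assoc, Real.Gamma_add_one hmd.ne']
    congr 1
    field_simp
  have hJ : hJacobi 0 ((m : ℝ) + ((d : ℝ) - 2) / 2) k = (m + d / 2) / ((m + 2 * k : ℕ) + d / 2) := by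
    have f1 := Nat.cast_ne_zero (R := ℝ).2 k.factorial_ne_zero
    have h1 := poch_succ ((m : ℝ) + d / 2) k
    rw [poch_succ'] at h1
    have hp := (poch_pos (show 0 < (m : ℝ) + d / 2 + 1 by linarith) k).ne'
    have h3 : (m : ℝ) + d / 2 + 2 * k ≠ 0 := by positivity
    rw [hJacobi, zero_add, zero_add, poch_one,
      show (m : ℝ) + ((d : ℝ) - 2) / 2 + 1 = m + d / 2 by ring,
      show (m : ℝ) + ((d : ℝ) - 2) / 2 + 2 = m + d / 2 + 1 by ring,
      show (m : ℝ) + ((d : ℝ) - 2) / 2 + k + 1 = m + d / 2 + k by ring,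
      show (m : ℝ) + ((d : ℝ) - 2) / 2 + 2 * k + 1 = m + d / 2 + 2 * k by ring,
      mul_assoc, ← h1, show ((m + 2 * k : ℕ) : ℝ) + d / 2 = m + d / 2 + 2 * k by push_cast; ring]
    generalize poch ((m : ℝ) + d / 2 + 1) k = p at hp
    field_simp
  rw [hnk0, e1, hJ, ← Real.sqrt_mul (by positivity)]
  congr 1
  field_simp

/-- The Radon transform maps the orthonormal basis element `f_{k,j}^n` of
`V_n^d` to `R f_{k,j}^n(ξ,t) = γ_n g_{k,j}^n(ξ,t)`, where the singular values
`γ_n = b_{d-1} √(n!/(d)_n)` depend only on `n`. -/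
theorem radon_singular_values (d n k : ℕ) (hd : 1 ≤ d) (hk : 2 * k ≤ n)
    (Y : Esp d → ℝ) (hY : IsSphHarm d (n - 2 * k) Y)
    (hYnorm : (sigmaConst d)⁻¹ *
        (∫ ξ : Metric.sphere (0 : Esp d) 1, Y (ξ : Esp d) * Y (ξ : Esp d) ∂(sphereMeasure d)) = 1)
    (ξ : Esp d) (hξ : ‖ξ‖ = 1) (t : ℝ) (ht : t ∈ Set.Icc (-1 : ℝ) 1) :
    radon (fkjBasis d n k Y) ξ t = svGamma d n * gkjBasis d n Y ξ t := by
  have hc := hnk_mul_sqrt_hJacobi hd hk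
  have hm : ((n - 2 * k : ℕ) : ℝ) = (n : ℝ) - 2 * k := by
    rw [Nat.cast_sub hk]
    push_cast
    ring
  have hd1 : (1 : ℝ) ≤ d := by exact_mod_cast hd
  have hm0 : (0 : ℝ) ≤ (n : ℝ) - 2 * k := hm ▸ Nat.cast_nonneg _
  have hint := hY.integral_section hξ hd k ht
  rw [hm, Nat.sub_add_cancel hk] at hint
  have hf : ∀ x, fkjBasis d n k Y x =
      (hnk d n k * √(hJacobi 0 ((n : ℝ) - 2 * k + ((d : ℝ) - 2) / 2) k))⁻¹ *
        ((∑ i ∈ Finset.range (k + 1), (-1) ^ i * k.choose i *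
          poch (k + ((n : ℝ) - 2 * k) + ((d : ℝ) - 1) / 2 + 1 / 2) i / i.factorial *
            (1 - ‖x‖ ^ 2) ^ i) * Y x) := fun x => by
    rw [fkjBasis, jacobiOrtho, jacobiP_zero_eq _ (by linarith),
      show (n : ℝ) - 2 * k + ((d : ℝ) - 2) / 2 + k + 1 =
        k + ((n : ℝ) - 2 * k) + ((d : ℝ) - 1) / 2 + 1 / 2 by ring, mul_inv]
    ring
  simp only [radon, hf]
  rw [integral_const_mul, hint, hc, svGamma, gkjBasis, ballVol, Nat.cast_sub hd, Nat.cast_one,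
    show ((d : ℝ) - 1 + 2) / 2 = ((d : ℝ) - 1) / 2 + 1 by ring, hGegen,
    show 2 * ((d : ℝ) / 2) = d by ring]
  have hp := poch_pos (show 0 < (d : ℝ) by linarith) n
  have hfac : (0 : ℝ) < n.factorial := by exact_mod_cast n.factorial_pos
  have hN : (0 : ℝ) < n.factorial / poch d n := div_pos hfac hp
  have hρ : 0 < (d : ℝ) / 2 / (n + d / 2) := by positivity
  rw [show (d : ℝ) / 2 * poch d n / ((n + d / 2) * n.factorial) =
    (d : ℝ) / 2 / (n + d / 2) / (n.factorial / poch d n) by field_simp, Real.sqrt_div hρ.le, inv_div]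
  have hs := Real.mul_self_sqrt hN.le
  linear_combination -(√((d : ℝ) / 2 / (n + d / 2)))⁻¹ * (Real.pi ^ (((d : ℝ) - 1) / 2) /
    Real.Gamma (((d : ℝ) - 1) / 2 + 1) * (1 - t ^ 2) ^ (((d : ℝ) - 1) / 2) *
      gegen ((d : ℝ) / 2) n t * Y ξ) * hs
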